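/- Let k ≥ 9 and let G be a finite simple graph of order n = k+4 whose average degree 2·e(G)/n is strictly greater than k−2 and whose maximum degree Δ(G) equals k−1. Then G contains every tree of order k whose diameter is at least 5 as a subgraph. -/

import Mathlib

open SimpleGraph

/-- A parent function and a depth function describing a tree rooted at `r`. -/
structure Rooting {W : Type*} (T : SimpleGraph W) (r : W) where
  par : W → W
  dep : W → ℕ
  dep_root : dep r = 0
  adj_par : ∀ a, a ≠ r → T.Adj a (par a)
  dep_par : ∀ a, a ≠ r → dep a = dep (par a) + 1
  adj_cases : ∀ a b, T.Adj a b → (a ≠ r ∧ par a = b) ∨ (b ≠ r ∧ par b = a)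

open scoped Classical in
theorem SimpleGraph.IsTree.nonempty_rooting {W : Type*} [Fintype W] {T : SimpleGraph W}
    (hT : T.IsTree) (r : W) : Nonempty (Rooting T r) := by
  have key : ∀ a, ∃ b, a ≠ r → T.Adj a b ∧ T.dist r a = T.dist r b + 1 := by
    intro a
    by_cases har : a = r
    · exact ⟨a, fun h => absurd har h⟩
    obtain ⟨p, hp, hlen⟩ := (hT.connected a r).exists_path_of_dist
    cases p with
    | nil => exact absurd rfl har
    | @cons _ b _ h q =>
      refine ⟨b, fun _ => ⟨h, ?_⟩⟩
      have h1 : T.dist b r ≤ q.length := SimpleGraph.dist_le q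
      have h2 := hT.connected.dist_triangle (u := r) (v := b) (w := a)
      have h3 : T.dist b a = 1 := dist_eq_one_iff_adj.2 h.symm
      simp only [Walk.length_cons] at hlen
      rw [T.dist_comm (u := r) (v := a), T.dist_comm (u := r) (v := b)] at *
      omega
  choose par hpar using key
  let φ : W → Sym2 W := fun a => s(a, par a)
  have hinj : Set.InjOn φ ((Finset.univ.erase r : Finset W) : Set W) := by
    intro a ha b hb hab
    have ha' := hpar a (by simpa using ha)
    have hb' := hpar b (by simpa using hb)
    simp only [φ, Sym2.eq_iff] at hab
    rcases hab with ⟨h, _⟩ | ⟨h1, h2⟩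
    · exact h
    · rw [← h1] at hb'
      rw [h2] at ha'
      omega
  have himg : (Finset.univ.erase r).image φ = T.edgeFinset := by
    apply Finset.eq_of_subset_of_card_le
    · intro x hx
      obtain ⟨a, ha, rfl⟩ := Finset.mem_image.1 hx
      have := (hpar a (by simpa using ha)).1
      simpa [φ] using this
    · rw [Finset.card_image_of_injOn hinj, Finset.card_erase_of_mem (Finset.mem_univ _),
        Finset.card_univ]
      have := hT.card_edgeFinset
      omega
  refine ⟨⟨par, T.dist r, by simp, fun a h => (hpar a h).1, fun a h => (hpar a h).2, ?_⟩⟩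
  intro a b hab
  have : s(a, b) ∈ (Finset.univ.erase r).image φ := by rw [himg]; simpa using hab
  obtain ⟨c, hc, hc'⟩ := Finset.mem_image.1 this
  have hcr : c ≠ r := by simpa using hc
  simp only [φ, Sym2.eq_iff] at hc'
  rcases hc' with ⟨rfl, h⟩ | ⟨rfl, h⟩
  · exact Or.inl ⟨hcr, h⟩
  · exact Or.inr ⟨hcr, h⟩

namespace Rooting
variable {W : Type*} {T : SimpleGraph W} {r : W} (R : Rooting T r)

theorem par_ne {a : W} (ha : a ≠ r) : R.par a ≠ a := (R.adj_par a ha).ne'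

theorem dep_pos {a : W} (ha : a ≠ r) : 0 < R.dep a := by
  rw [R.dep_par a ha]; omega

theorem par_ne_child {a b : W} (ha : a ≠ r) (hb : b ≠ r) (h : R.par b = a) : R.par a ≠ b := by
  intro h'
  have h1 := R.dep_par a ha
  have h2 := R.dep_par b hb
  rw [h] at h2
  rw [h'] at h1
  omega

open scoped Classical in
/-- A non-root vertex with two distinct children has degree at least three. -/
theorem three_le_degree [Fintype W] {a b c : W} (ha : a ≠ r) (hb : b ≠ r) (hc : c ≠ r)
    (hbc : b ≠ c) (hpb : R.par b = a) (hpc : R.par c = a) : 3 ≤ T.degree a := by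
  rw [← card_neighborFinset_eq_degree, ← Finset.card_eq_three.2 ⟨R.par a, b, c,
    R.par_ne_child ha hb hpb, R.par_ne_child ha hc hpc, hbc, rfl⟩]
  apply Finset.card_le_card
  intro x hx
  simp only [Finset.mem_insert, Finset.mem_singleton] at hx
  rw [mem_neighborFinset]
  rcases hx with rfl | rfl | rfl
  · exact R.adj_par a ha
  · rw [← hpb]; exact (R.adj_par _ hb).symm
  · rw [← hpc]; exact (R.adj_par _ hc).symm

open scoped Classical in
theorem two_le_degree [Fintype W] {a b : W} (ha : a ≠ r) (hb : b ≠ r)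
    (hpb : R.par b = a) : 2 ≤ T.degree a := by
  rw [← card_neighborFinset_eq_degree, ← Finset.card_pair (R.par_ne_child ha hb hpb)]
  apply Finset.card_le_card
  intro x hx
  simp only [Finset.mem_insert, Finset.mem_singleton] at hx
  rw [mem_neighborFinset]
  rcases hx with rfl | rfl
  · exact R.adj_par a ha
  · rw [← hpb]; exact (R.adj_par _ hb).symm

/-- A set closed under taking parents, and containing every vertex whose parent it contains,
is everything. -/
theorem mem_of_closed {S : Set W} (hr : r ∈ S) (h : ∀ a, a ≠ r → R.par a ∈ S → a ∈ S) (a : W) :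
    a ∈ S := by
  induction hd : R.dep a using Nat.strong_induction_on generalizing a with
  | _ d ih =>
    by_cases har : a = r
    · exact har ▸ hr
    · exact h a har (ih (R.dep (R.par a)) (by have := R.dep_par a har; omega) _ rfl)

end Rooting

/-- `q 0, …, q (n - 1)`, with `n` the order of `G`, runs through a Hamiltonian cycle of `G`. -/
def IsHamSeq {V : Type*} [Fintype V] (G : SimpleGraph V) (q : ℕ → V) : Prop :=
  Set.InjOn q (Set.Iio (Fintype.card V)) ∧
    (∀ i, i + 1 < Fintype.card V → G.Adj (q i) (q (i + 1))) ∧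
    G.Adj (q (Fintype.card V - 1)) (q 0)

/-- The cyclic rotation by `s` of the first `n` terms of a sequence. -/
def rotateSeq {V : Type*} (n : ℕ) (q : ℕ → V) (s j : ℕ) : V :=
  if s + j < n then q (s + j) else q (s + j - n)

namespace IsHamSeq
variable {V : Type*} [Fintype V] {G : SimpleGraph V} {q : ℕ → V}

theorem exists_index (hq : Set.InjOn q (Set.Iio (Fintype.card V))) (v : V) :
    ∃ i < Fintype.card V, q i = v := by
  classical
  have h : (Finset.range (Fintype.card V)).image q = Finset.univ := by
    apply Finset.eq_univ_of_card
    rw [Finset.card_image_of_injOn (by simpa using hq), Finset.card_range]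
  have := h ▸ Finset.mem_univ v
  simpa using this

theorem rotate (hq : IsHamSeq G q) {s : ℕ} (hs : s < Fintype.card V) :
    IsHamSeq G (rotateSeq (Fintype.card V) q s) := by
  obtain ⟨h1, h2, h3⟩ := hq
  unfold IsHamSeq rotateSeq
  generalize Fintype.card V = n at *
  refine ⟨?_, ?_, ?_⟩
  · intro i hi j hj hij
    simp only [Set.mem_Iio] at hi hj
    dsimp only at hij
    split_ifs at hij with ha hb hb
    all_goals
      have := h1 (Set.mem_Iio.2 (by omega)) (Set.mem_Iio.2 (by omega)) hij
      omega
  · intro i hi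
    split_ifs with ha hb hb
    · exact h2 _ (by omega)
    · have e1 : s + i = n - 1 := by omega
      have e2 : s + (i + 1) - n = 0 := by omega
      rw [e1, e2]; exact h3
    · omega
    · have e2 : s + (i + 1) - n = s + i - n + 1 := by omega
      rw [e2]; exact h2 _ (by omega)
  · split_ifs with ha hb hb
    · have : s = 0 := by omega
      subst this
      simpa using h3
    · omega
    · have e2 : s + 0 = s + (n - 1) - n + 1 := by omega
      rw [e2]
      exact h2 _ (by omega)
    · omega

end IsHamSeq

theorem exists_ham_path_of_edge {V : Type*} [Fintype V] {G : SimpleGraph V} {u v : V}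
    (hn : 3 ≤ Fintype.card V) (hG : ¬ ∃ q, IsHamSeq G q)
    (hq : ∃ q, IsHamSeq (G ⊔ edge u v) q) :
    ∃ p : ℕ → V, Set.InjOn p (Set.Iio (Fintype.card V)) ∧
      (∀ i, i + 1 < Fintype.card V → G.Adj (p i) (p (i + 1))) ∧
      p 0 = u ∧ p (Fintype.card V - 1) = v := by
  set n := Fintype.card V with hnd
  have hadj : ∀ x y, (G ⊔ edge u v).Adj x y → ¬ G.Adj x y → (x = u ∧ y = v) ∨ (x = v ∧ y = u) := by
    intro x y h h'
    simp only [sup_adj, edge_adj] at h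
    tauto
  -- it suffices to find a sequence of the larger graph closing up along the new edge
  suffices h : ∃ q, IsHamSeq (G ⊔ edge u v) q ∧ ¬ G.Adj (q (n - 1)) (q 0) by
    obtain ⟨q, ⟨h1, h2, h3⟩, h4⟩ := h
    have hGi : ∀ i, i + 1 < n → G.Adj (q i) (q (i + 1)) := by
      intro i hi
      by_contra hc
      have inj : ∀ a b, a < n → b < n → q a = q b → a = b := fun a b ha hb h => h1 ha hb h
      have e0 := inj 0 (i + 1) (by omega) (by omega)
      have e1 := inj 0 i (by omega) (by omega)
      have e2 := inj (n - 1) i (by omega) (by omega)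
      have e3 := inj (n - 1) (i + 1) (by omega) (by omega)
      rcases hadj _ _ (h2 i hi) hc with ⟨a, b⟩ | ⟨a, b⟩ <;>
        rcases hadj _ _ h3 h4 with ⟨c, d⟩ | ⟨c, d⟩ <;> grind
    rcases hadj _ _ h3 h4 with ⟨c, d⟩ | ⟨c, d⟩
    · refine ⟨fun i => q (n - 1 - i), ?_, ?_, ?_, ?_⟩
      · intro i hi j hj hij
        simp only [Set.mem_Iio] at hi hj
        have := h1 (Set.mem_Iio.2 (by omega)) (Set.mem_Iio.2 (by omega)) hij
        omega
      · intro i hi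
        have e : n - 1 - i = n - 1 - (i + 1) + 1 := by omega
        dsimp only
        rw [e]
        exact (hGi _ (by omega)).symm
      · simpa using c
      · simpa using d
    · exact ⟨q, h1, hGi, d, c⟩
  obtain ⟨q, hq⟩ := hq
  by_cases hlast : G.Adj (q (n - 1)) (q 0)
  · have : ∃ i, i + 1 < n ∧ ¬ G.Adj (q i) (q (i + 1)) := by
      by_contra! hc
      exact hG ⟨q, hq.1, hc, hlast⟩
    obtain ⟨i, hi, hni⟩ := this
    refine ⟨_, hq.rotate (s := i + 1) hi, ?_⟩
    unfold rotateSeq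
    rw [if_neg (by omega), if_pos (by omega)]
    have e : i + 1 + (n - 1) - n = i := by omega
    rw [← hnd, e]
    simpa using hni
  · exact ⟨q, hq, hlast⟩

open scoped Classical in
theorem degree_add_degree_lt_of_ham_path {V : Type*} [Fintype V] {G : SimpleGraph V} {u v : V}
    (hG : ¬ ∃ q, IsHamSeq G q) {p : ℕ → V}
    (hinj : Set.InjOn p (Set.Iio (Fintype.card V)))
    (hadj : ∀ i, i + 1 < Fintype.card V → G.Adj (p i) (p (i + 1)))
    (h0 : p 0 = u) (hlast : p (Fintype.card V - 1) = v) :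
    ∃ A : Finset V, A.card = G.degree u ∧ v ∉ A ∧ ∀ x ∈ A, ¬ G.Adj x v := by
  set n := Fintype.card V with hnd
  have hpos : 0 < n := Fintype.card_pos_iff.2 ⟨u⟩
  let J := (Finset.range (n - 1)).filter (fun j => G.Adj u (p (j + 1)))
  have hpJ : Set.InjOn p (J : Set ℕ) := by
    intro a ha b hb hab
    simp only [J, Finset.coe_filter, Finset.mem_range, Set.mem_ofPred_eq] at ha hb
    exact hinj (Set.mem_Iio.2 (by omega)) (Set.mem_Iio.2 (by omega)) hab
  refine ⟨J.image p, ?_, ?_, ?_⟩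
  · rw [Finset.card_image_of_injOn hpJ, ← card_neighborFinset_eq_degree]
    apply Finset.card_bij (fun j _ => p (j + 1))
    · intro j hj
      simpa using (Finset.mem_filter.1 hj).2
    · intro a ha b hb hab
      simp only [J, Finset.mem_filter, Finset.mem_range] at ha hb
      have := hinj (Set.mem_Iio.2 (by omega)) (Set.mem_Iio.2 (by omega)) hab
      omega
    · intro w hw
      rw [mem_neighborFinset] at hw
      obtain ⟨i, hi, rfl⟩ := IsHamSeq.exists_index hinj w
      have : i ≠ 0 := by
        rintro rfl
        rw [h0] at hw
        exact hw.ne rfl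
      refine ⟨i - 1, ?_, by congr 1; omega⟩
      have e : i - 1 + 1 = i := by omega
      simp only [J, Finset.mem_filter, Finset.mem_range, e]
      exact ⟨by omega, hw⟩
  · intro hv
    obtain ⟨j, hj, hjv⟩ := Finset.mem_image.1 hv
    simp only [J, Finset.mem_filter, Finset.mem_range] at hj
    rw [← hlast] at hjv
    have := hinj (Set.mem_Iio.2 (by omega)) (Set.mem_Iio.2 (by omega)) hjv
    omega
  · intro x hx hxv
    obtain ⟨j, hj, rfl⟩ := Finset.mem_image.1 hx
    simp only [J, Finset.mem_filter, Finset.mem_range] at hj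
    apply hG
    refine ⟨fun i => if i ≤ j then p i else p (n + j - i), ?_, ?_, ?_⟩
    · intro a ha b hb hab
      simp only [Set.mem_Iio] at ha hb
      dsimp only at hab
      split_ifs at hab
      all_goals
        have := hinj (Set.mem_Iio.2 (by omega)) (Set.mem_Iio.2 (by omega)) hab
        omega
    · intro i hi
      dsimp only
      split_ifs with h1 h2 h2
      · exact hadj i hi
      · have e1 : i = j := by omega
        have e2 : n + j - (i + 1) = n - 1 := by omega
        rw [e2, hlast, e1]
        exact hxv
      · omega
      · have e : n + j - i = n + j - (i + 1) + 1 := by omega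
        rw [e]
        exact (hadj _ (by omega)).symm
    · dsimp only
      rw [if_neg (by omega), if_pos (by omega), h0]
      have e : n + j - (n - 1) = j + 1 := by omega
      rw [← hnd, e]
      exact hj.2.symm

theorem exists_isHamSeq_top (V : Type*) [Fintype V] (hn : 2 ≤ Fintype.card V) :
    ∃ q, IsHamSeq (⊤ : SimpleGraph V) q := by
  have e := Fintype.equivFin V
  let q : ℕ → V := fun i => if h : i < Fintype.card V then e.symm ⟨i, h⟩ else e.symm ⟨0, by omega⟩
  have hq : Set.InjOn q (Set.Iio (Fintype.card V)) := by
    intro a ha b hb hab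
    simp only [Set.mem_Iio] at ha hb
    simpa [q, ha, hb] using hab
  refine ⟨q, hq, fun i hi h => ?_, fun h => ?_⟩
  · have := hq (Set.mem_Iio.2 (by omega)) (Set.mem_Iio.2 (by omega)) h
    omega
  · have := hq (Set.mem_Iio.2 (by omega)) (Set.mem_Iio.2 (by omega)) h
    omega

open scoped Classical in
/-- Pósa's degree condition for Hamiltonicity. -/
theorem exists_isHamSeq_of_posa {V : Type*} [Fintype V] (G : SimpleGraph V)
    (hn : 3 ≤ Fintype.card V)
    (h1 : ∀ h, 2 * h + 1 < Fintype.card V →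
      (Finset.univ.filter fun v => G.degree v ≤ h).card = 0 ∨
      (Finset.univ.filter fun v => G.degree v ≤ h).card < h)
    (h2 : ∀ h, 2 * h + 1 = Fintype.card V →
      (Finset.univ.filter fun v => G.degree v ≤ h).card ≤ h) :
    ∃ q, IsHamSeq G q := by
  induction G using WellFoundedGT.induction with
  | _ G ih =>
  by_contra hG
  have hsup : ∀ u v, u ≠ v → ¬ G.Adj u v → ∃ q, IsHamSeq (G ⊔ edge u v) q := by
    intro u v huv hn'
    have hlt : G < G ⊔ edge u v := lt_sup_edge G u v huv hn'
    generalize G ⊔ edge u v = G' at hlt ⊢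
    have hmono : ∀ h, (Finset.univ.filter fun x => G'.degree x ≤ h).card ≤
        (Finset.univ.filter fun x => G.degree x ≤ h).card := by
      intro h
      apply Finset.card_le_card
      intro x hx
      simp only [Finset.mem_filter, Finset.mem_univ, true_and] at hx ⊢
      exact (degree_le_of_le hlt.le).trans hx
    refine ih _ hlt ?_ ?_
    · intro h hh
      have := h1 h hh
      have := hmono h
      omega
    · intro h hh
      exact (hmono h).trans (h2 h hh)
  let P := (Finset.univ : Finset (V × V)).filter (fun x => x.1 ≠ x.2 ∧ ¬ G.Adj x.1 x.2)
  have hP : P.Nonempty := by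
    by_contra hP
    rw [Finset.not_nonempty_iff_eq_empty, Finset.filter_eq_empty_iff] at hP
    apply hG
    have : G = ⊤ := by
      ext a b
      have := hP (Finset.mem_univ (a, b))
      simp only [top_adj]
      exact ⟨fun h => h.ne, fun h => by tauto⟩
    rw [this]
    exact exists_isHamSeq_top V (by omega)
  obtain ⟨⟨u, v⟩, huvP, hmax⟩ := P.exists_max_image (fun x => G.degree x.1 + G.degree x.2) hP
  simp only [P, Finset.mem_filter, Finset.mem_univ, true_and, Prod.forall] at huvP hmax
  wlog hle : G.degree u ≤ G.degree v generalizing u v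
  · apply this v u ⟨huvP.1.symm, fun h => huvP.2 h.symm⟩
    · intro a b hab
      have := hmax a b hab
      omega
    · omega
  obtain ⟨p, hinj, hadj, h0, hlast⟩ := exists_ham_path_of_edge hn hG (hsup u v huvP.1 huvP.2)
  obtain ⟨A, hAc, hvA, hA⟩ := degree_add_degree_lt_of_ham_path hG hinj hadj h0 hlast
  have hAdeg : ∀ x ∈ A, G.degree x ≤ G.degree u := by
    intro x hx
    have := hmax x v ⟨fun h => hvA (h ▸ hx), hA x hx⟩
    omega
  have hsum : G.degree u + G.degree v + 1 ≤ Fintype.card V := by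
    have hdisj : Disjoint A (insert v (G.neighborFinset v)) := by
      rw [Finset.disjoint_left]
      intro x hx hx'
      rw [Finset.mem_insert, mem_neighborFinset] at hx'
      rcases hx' with rfl | h
      · exact hvA hx
      · exact hA x hx h.symm
    have := Finset.card_union_of_disjoint hdisj
    rw [Finset.card_insert_of_notMem (by simp), card_neighborFinset_eq_degree, hAc] at this
    have h' := Finset.card_le_univ (A ∪ insert v (G.neighborFinset v))
    omega
  have hsub : A ⊆ Finset.univ.filter fun x => G.degree x ≤ G.degree u := by
    intro x hx
    simpa using hAdeg x hx
  have hcu : 0 < (Finset.univ.filter fun x => G.degree x ≤ G.degree u).card :=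
    Finset.card_pos.2 ⟨u, by simp⟩
  have hcA := Finset.card_le_card hsub
  by_cases hcase : 2 * G.degree u + 1 < Fintype.card V
  · have := h1 _ hcase
    omega
  · have heq : 2 * G.degree u + 1 = Fintype.card V := by omega
    have := h2 _ heq
    have hsub' : insert v A ⊆ Finset.univ.filter fun x => G.degree x ≤ G.degree u := by
      intro x hx
      rcases Finset.mem_insert.1 hx with rfl | hx
      · simp only [Finset.mem_filter, Finset.mem_univ, true_and]
        omega
      · exact hsub hx
    have := Finset.card_le_card hsub'
    rw [Finset.card_insert_of_notMem hvA] at this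
    omega

open scoped Classical in
theorem exists_isHamSeq_of_deficiency {V : Type*} [Fintype V] {G : SimpleGraph V} {k : ℕ}
    (hk : 9 ≤ k) {d : V → ℕ} (hd : ∀ v, G.degree v + d v + 1 = k)
    (hsum : ∑ v, d v < Fintype.card V) (hn : Fintype.card V ≤ k + 4)
    (hkn : k ≤ Fintype.card V) (hsmall : ∀ v, 2 * d v < k) : ∃ q, IsHamSeq G q := by
  have hcount : ∀ h, h + 1 ≤ k → (Finset.univ.filter fun v => G.degree v ≤ h).card * (k - 1 - h) <
      Fintype.card V := by
    intro h hh
    refine lt_of_le_of_lt ?_ hsum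
    rw [← smul_eq_mul]
    refine (Finset.card_nsmul_le_sum _ d _ ?_).trans
      (Finset.sum_le_sum_of_subset (Finset.subset_univ _))
    intro v hv
    have := (Finset.mem_filter.1 hv).2
    have := hd v
    omega
  apply exists_isHamSeq_of_posa G (by omega)
  · intro h hh
    by_contra! hc
    obtain ⟨v, hv⟩ := Finset.card_pos.1 (Nat.pos_of_ne_zero hc.1)
    have hv' := (Finset.mem_filter.1 hv).2
    have h1 := hd v
    have h2 := hsmall v
    have h3 := hcount h (by omega)
    have h4 := Nat.mul_le_mul_right (k - 1 - h) hc.2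
    obtain ⟨t, ht⟩ : ∃ t, 2 * h = k - 1 + t := ⟨2 * h - (k - 1), by omega⟩
    have ht3 : t ≤ 3 := by omega
    have hkh : k - 1 - h = h - t := by omega
    rw [hkh] at h3 h4
    obtain ⟨x, rfl⟩ : ∃ x, h = x + t := ⟨h - t, by omega⟩
    rw [Nat.add_sub_cancel] at h3 h4
    have hx : (9 - t) / 2 ≤ x := by omega
    have h5 : (x + t) * x < 2 * x + t + 5 := by
      have := h4.trans_lt h3
      omega
    clear * - h5 hx ht3
    interval_cases t <;> norm_num at hx <;> nlinarith
  · intro h hh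
    by_contra! hc
    have h3 := hcount h (by omega)
    have h4 := Nat.mul_le_mul_right (k - 1 - h) (Nat.succ_le_of_lt hc)
    obtain ⟨t, ht⟩ : ∃ t, 2 * h = k - 1 + t := ⟨2 * h - (k - 1), by omega⟩
    have ht3 : t ≤ 4 := by omega
    have hkh : k - 1 - h = h - t := by omega
    rw [hkh] at h3 h4
    obtain ⟨x, rfl⟩ : ∃ x, h = x + t := ⟨h - t, by omega⟩
    rw [Nat.add_sub_cancel] at h3 h4
    simp only [Nat.succ_eq_add_one] at h4
    have hx : (9 - t) / 2 ≤ x := by omega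
    have h5 := (h4.trans_lt h3).trans_eq hh.symm
    clear * - h5 hx ht3
    interval_cases t <;> norm_num at hx <;> nlinarith

/-- In the list `l`, the value of `ν` at an entry is at most `σ` plus the number of later
entries. -/
def GradedBy {W : Type*} (ν : W → ℕ) (σ : ℕ) : List W → Prop
  | [] => True
  | y :: l => ν y ≤ σ + l.length ∧ GradedBy ν σ l

namespace GradedBy
variable {W : Type*} {ν ν' : W → ℕ} {σ σ' : ℕ}

theorem mono {l : List W} (h : GradedBy ν σ l) (hν : ∀ y ∈ l, ν' y + σ ≤ ν y + σ') :
    GradedBy ν' σ' l := by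
  induction l with
  | nil => trivial
  | cons y l ih =>
    have := hν y (by simp)
    have := h.1
    exact ⟨by omega, ih h.2 fun x hx => hν x (by simp [hx])⟩

theorem remove {l₁ l₂ : List W} {y : W} (h : GradedBy ν σ (l₁ ++ y :: l₂))
    (h₁ : ∀ x ∈ l₁, ν' x + 1 ≤ ν x) (h₂ : ∀ x ∈ l₂, ν' x ≤ ν x) :
    GradedBy ν' σ (l₁ ++ l₂) := by
  induction l₁ with
  | nil => exact mono h.2 fun x hx => by have := h₂ x hx; omega
  | cons x l ih =>
    have h3 := h₁ x (by simp)
    have h4 := h.1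
    simp only [List.append_eq, List.length_append, List.length_cons] at h4
    refine ⟨?_, ih h.2 fun z hz => h₁ z (by simp [hz])⟩
    simp only [List.append_eq, List.length_append]
    omega

theorem exists_le {l : List W} (h : GradedBy ν σ l) (hl : l ≠ []) : ∃ y ∈ l, ν y ≤ σ := by
  induction l with
  | nil => exact absurd rfl hl
  | cons y l ih =>
    by_cases hl' : l = []
    · subst hl'
      exact ⟨y, by simp, by simpa using h.1⟩
    · obtain ⟨x, hx, hx'⟩ := ih h.2 hl'
      exact ⟨x, by simp [hx], hx'⟩

end GradedBy

/-- A partial embedding of a rooted tree, defined on a set of vertices closed under parents,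
together with a path avoiding its image. -/
structure PathExtension {V W : Type*} (G : SimpleGraph V) {T : SimpleGraph W} {r : W}
    (R : Rooting T r) (S : Finset W) (f : W → V) (Z : List V) : Prop where
  root_mem : r ∈ S
  par_mem : ∀ a ∈ S, a ≠ r → R.par a ∈ S
  unique_child : ∀ b c, b ≠ r → c ≠ r → R.par b = R.par c → R.par b ∉ S → b = c
  injOn : Set.InjOn f S
  adj : ∀ a ∈ S, a ≠ r → G.Adj (f a) (f (R.par a))
  nodup : Z.Nodup
  disjoint : ∀ z ∈ Z, ∀ a ∈ S, f a ≠ z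
  chain : Z.IsChain G.Adj

namespace PathExtension
variable {V W : Type*} {G : SimpleGraph V} {T : SimpleGraph W} {r : W} {R : Rooting T r}
  {S : Finset W} {f : W → V} {z : V} {Z : List V}

theorem tail (h : PathExtension G R S f (z :: Z)) : PathExtension G R S f Z :=
  ⟨h.1, h.2, h.3, h.4, h.5, h.6.of_cons, fun x hx => h.7 x (by simp [hx]), h.8.tail⟩

open scoped Classical in
theorem place (h : PathExtension G R S f (z :: Z)) {y : W} (hy : y ∉ S) (hpy : R.par y ∈ S)
    (hadj : G.Adj (f (R.par y)) z) :
    PathExtension G R (insert y S) (Function.update f y z) Z := by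
  have hne : ∀ a ∈ S, a ≠ y := fun a ha h => hy (h ▸ ha)
  have hup : ∀ a ∈ S, Function.update f y z a = f a := fun a ha =>
    Function.update_of_ne (hne a ha) _ _
  refine ⟨by simp [h.1], ?_, ?_, ?_, ?_, h.6.of_cons, ?_, h.8.tail⟩
  · intro a ha har
    rcases Finset.mem_insert.1 ha with rfl | ha
    · simp [hpy]
    · simp [h.2 a ha har]
  · intro b c hb hc hbc hn
    exact h.3 b c hb hc hbc fun h' => hn (by simp [h'])
  · intro a ha b hb hab
    simp only [Finset.coe_insert, Set.mem_insert_iff, Finset.mem_coe] at ha hb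
    rcases ha with rfl | ha <;> rcases hb with rfl | hb
    · rfl
    · rw [hup b hb, Function.update_self] at hab
      exact absurd hab.symm (h.7 z (by simp) b hb)
    · rw [hup a ha, Function.update_self] at hab
      exact absurd hab (h.7 z (by simp) a ha)
    · rw [hup a ha, hup b hb] at hab
      exact h.4 ha hb hab
  · intro a ha har
    rcases Finset.mem_insert.1 ha with rfl | ha
    · rw [Function.update_self, hup _ hpy]
      exact hadj.symm
    · rw [hup a ha, hup _ (h.2 a ha har)]
      exact h.5 a ha har
  · intro x hx a ha
    rcases Finset.mem_insert.1 ha with rfl | ha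
    · rw [Function.update_self]
      rintro rfl
      exact (List.nodup_cons.1 h.6).1 hx
    · rw [hup a ha]
      exact h.7 x (by simp [hx]) a ha

open scoped Classical in
/-- Complete a partial embedding by feeding the vertices of the path one at a time to the
pending branches; `act` is a branch in the course of being embedded. -/
theorem exists_embedding [Fintype W] (Z : List V) : ∀ (S : Finset W) (f : W → V) (l : List W)
    (act : Option W) (σ : ℕ), PathExtension G R S f Z →
    Z.length + S.card = Fintype.card W + σ → l.Nodup →
    (∀ y ∈ l, y ∉ S ∧ R.par y ∈ S) →
    (∀ y ∈ act, y ∉ S ∧ R.par y ∈ S ∧ y ∉ l ∧ ∀ z ∈ Z.head?, G.Adj (f (R.par y)) z) →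
    (∀ y, y ∉ S → R.par y ∈ S → y ∈ l ∨ y ∈ act) →
    GradedBy (fun y => Z.countP (fun z => ¬ G.Adj (f (R.par y)) z)) σ l →
    ∃ f' : W → V, Function.Injective f' ∧ ∀ a, a ≠ r → G.Adj (f' a) (f' (R.par a)) := by
  induction Z with
  | nil =>
    intro S f l act σ h hcard _ _ _ _ _
    have hS : S = Finset.univ := by
      apply Finset.eq_univ_of_card
      have := Finset.card_le_univ S
      simp only [List.length_nil] at hcard
      omega
    subst hS
    exact ⟨f, by simpa using h.4, fun a ha => h.5 a (Finset.mem_univ _) ha⟩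
  | cons z Z ih =>
    intro S f l act σ h hcard hl hlS hact hcov hgr
    have hplace : ∀ (y : W) (l' : List W), y ∉ S → R.par y ∈ S → G.Adj (f (R.par y)) z →
        l'.Nodup → y ∉ l' → (∀ x ∈ l', x ∉ S ∧ R.par x ∈ S) →
        (∀ x, x ∉ S → R.par x ∈ S → x = y ∨ x ∈ l') →
        GradedBy (fun y => Z.countP (fun z => ¬ G.Adj (f (R.par y)) z)) σ l' →
        ∃ f' : W → V, Function.Injective f' ∧ ∀ a, a ≠ r → G.Adj (f' a) (f' (R.par a)) := by
      intro y l' hy hpy hadj hl' hyl' hl'S hcov' hgr'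
      have hyr : y ≠ r := fun h' => hy (h' ▸ h.1)
      have hup : ∀ a ∈ S, Function.update f y z a = f a := fun a ha =>
        Function.update_of_ne (by rintro rfl; exact hy ha) _ _
      have hl'2 : ∀ x ∈ l', x ∉ insert y S ∧ R.par x ∈ insert y S := by
        intro x hx
        have h1 := hl'S x hx
        simp only [Finset.mem_insert, not_or]
        exact ⟨⟨fun h' => hyl' (h' ▸ hx), h1.1⟩, Or.inr h1.2⟩
      have hchild : ∀ x, x ∉ insert y S → R.par x = y → ∀ w ∈ Z.head?,
          G.Adj (Function.update f y z (R.par x)) w := by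
        intro x _ hxy w hw
        rw [hxy, Function.update_self]
        cases Z with
        | nil => simp at hw
        | cons z' Z =>
          simp only [List.head?_cons, Option.mem_def, Option.some.injEq] at hw
          subst hw
          exact (List.isChain_cons_cons.1 h.8).1
      have hcard' : Z.length + (insert y S).card = Fintype.card W + σ := by
        rw [Finset.card_insert_of_notMem hy]
        simp only [List.length_cons] at hcard
        omega
      have hgr2 : GradedBy (fun x => Z.countP
          (fun w => ¬ G.Adj (Function.update f y z (R.par x)) w)) σ l' := by
        apply hgr'.mono
        intro x hx
        rw [hup _ (hl'S x hx).2]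
      by_cases hc : ∃ c, c ∉ insert y S ∧ R.par c = y
      · obtain ⟨c, hcS, hc⟩ := hc
        have hcr : c ≠ r := fun h' => hcS (by simp [h', h.1])
        refine ih (insert y S) (Function.update f y z) l' (some c) σ (h.place hy hpy hadj) hcard'
          hl' hl'2 ?_ ?_ hgr2
        · intro x hx
          simp only [Option.mem_def, Option.some.injEq] at hx
          subst hx
          exact ⟨hcS, by simp [hc], fun h' => hy (hc ▸ (hl'S _ h').2), hchild _ hcS hc⟩
        · intro x hx hpx
          simp only [Finset.mem_insert, not_or] at hx
          have hxr : x ≠ r := fun h' => hx.2 (h' ▸ h.1)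
          rcases Finset.mem_insert.1 hpx with hpx | hpx
          · right
            simp only [Option.mem_def, Option.some.injEq]
            exact h.3 c x hcr hxr (by rw [hc, hpx]) (by rwa [hc])
          · rcases hcov' x hx.2 hpx with h' | h'
            · exact absurd h' hx.1
            · exact Or.inl h'
      · push Not at hc
        refine ih (insert y S) (Function.update f y z) l' none σ (h.place hy hpy hadj) hcard'
          hl' hl'2 (by simp) ?_ hgr2
        intro x hx hpx
        simp only [Finset.mem_insert, not_or] at hx
        rcases Finset.mem_insert.1 hpx with hpx | hpx
        · exact absurd hpx (hc x (by simp [hx]))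
        · rcases hcov' x hx.2 hpx with h' | h'
          · exact absurd h' hx.1
          · exact Or.inl h'
    have hle : ∀ y, Z.countP (fun w => ¬ G.Adj (f (R.par y)) w) ≤
        (z :: Z).countP (fun w => ¬ G.Adj (f (R.par y)) w) := by
      intro y
      rw [List.countP_cons]
      omega
    have hlt : ∀ y, ¬ G.Adj (f (R.par y)) z → Z.countP (fun w => ¬ G.Adj (f (R.par y)) w) + 1 =
        (z :: Z).countP (fun w => ¬ G.Adj (f (R.par y)) w) := by
      intro y hy
      rw [List.countP_cons_of_pos (by simpa using hy)]
    cases act with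
    | some y =>
      obtain ⟨h1, h2, h3, h4⟩ := hact y rfl
      refine hplace y l h1 h2 (h4 z rfl) hl h3 hlS ?_ (hgr.mono fun x _ => by
        have := hle x; omega)
      intro x hx hpx
      rcases hcov x hx hpx with h' | h'
      · exact Or.inr h'
      · simp only [Option.mem_def, Option.some.injEq] at h'
        exact Or.inl h'.symm
    | none =>
      by_cases hex : ∃ y ∈ l, G.Adj (f (R.par y)) z
      · obtain ⟨y, l₁, l₂, h₁, hy, rfl, -⟩ := List.exists_of_eraseP (p := fun y =>
          decide (G.Adj (f (R.par y)) z)) hex.choose_spec.1 (by simpa using hex.choose_spec.2)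
        have hyS := hlS y (by simp)
        rw [List.nodup_middle, List.nodup_cons] at hl
        refine hplace y (l₁ ++ l₂) hyS.1 hyS.2 (by simpa using hy) hl.2 hl.1 ?_ ?_ ?_
        · intro x hx
          apply hlS x
          simp only [List.mem_append, List.mem_cons] at hx ⊢
          tauto
        · intro x hx hpx
          have := hcov x hx hpx
          simp only [List.mem_append, List.mem_cons, Option.mem_def, reduceCtorEq, or_false]
            at this ⊢
          tauto
        · refine hgr.remove ?_ ?_
          · intro x hx
            exact (hlt x (by simpa using h₁ x hx)).le
          · intro x _
            exact hle x
      · push Not at hex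
        by_cases hl0 : l = []
        · have hS : ∀ a, a ∈ S := by
            intro a
            refine R.mem_of_closed (S := (S : Set W)) h.1 ?_ a
            intro a _ hpa
            by_contra ha
            have := hcov a ha hpa
            simp [hl0] at this
          exact ⟨f, fun a b hab => h.4 (hS a) (hS b) hab, fun a ha => h.5 a (hS a) ha⟩
        · obtain ⟨y, hy, hyσ⟩ := hgr.exists_le hl0
          have h1 := hlt y (hex y hy)
          obtain ⟨σ, rfl⟩ : ∃ τ, σ = τ + 1 := ⟨σ - 1, by omega⟩
          refine ih S f l none σ h.tail ?_ hl hlS (by simp) hcov ?_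
          · simp only [List.length_cons] at hcard
            omega
          · apply hgr.mono
            intro x hx
            have := hlt x (hex x hx)
            omega

end PathExtension

open scoped Classical in
theorem card_not_gradedBy_le {V W : Type*} [Fintype V] {n : ℕ} {q : ℕ → V}
    (hq : Set.InjOn q (Set.Iio n)) (d : V → ℕ) (a : W → ℕ) (l : List W)
    (hl : ∀ y ∈ l, a y < n) :
    ((Finset.range n).filter fun θ =>
      ¬ GradedBy (fun y => d (rotateSeq n q θ (a y))) 0 l).card ≤
    ∑ i ∈ Finset.range l.length, (Finset.univ.filter fun v => i < d v).card := by
  induction l with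
  | nil => simp [GradedBy]
  | cons y l ih =>
    have ih' := ih fun x hx => hl x (by simp [hx])
    have hy := hl y (by simp)
    have hbad : ((Finset.range n).filter fun θ =>
        l.length < d (rotateSeq n q θ (a y))).card ≤
        (Finset.univ.filter fun v => l.length < d v).card := by
      apply Finset.card_le_card_of_injOn (fun θ => rotateSeq n q θ (a y))
      · intro θ hθ
        simpa using (Finset.mem_filter.1 hθ).2
      · intro θ hθ θ' hθ' h
        simp only [Finset.coe_filter, Finset.mem_range, Set.mem_ofPred_eq] at hθ hθ'
        simp only [rotateSeq] at h
        split_ifs at h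
        all_goals
          have := hq (Set.mem_Iio.2 (by omega)) (Set.mem_Iio.2 (by omega)) h
          omega
    rw [List.length_cons, Finset.sum_range_succ]
    refine le_trans ?_ (add_le_add ih' hbad)
    refine le_trans (Finset.card_le_card ?_) (Finset.card_union_le _ _)
    intro θ hθ
    simp only [Finset.mem_filter, Finset.mem_union, Finset.mem_range, GradedBy, not_and_or,
      not_le, zero_add] at hθ ⊢
    tauto

open scoped Classical in
theorem sum_card_lt_le_sum {V : Type*} [Fintype V] (d : V → ℕ) (m : ℕ) :
    ∑ i ∈ Finset.range m, (Finset.univ.filter fun v => i < d v).card ≤ ∑ v, d v := by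
  simp only [Finset.card_filter]
  rw [Finset.sum_comm]
  apply Finset.sum_le_sum
  intro v _
  rw [← Finset.card_filter]
  calc _ ≤ (Finset.range (d v)).card := by
        apply Finset.card_le_card
        intro i hi
        simpa using (Finset.mem_filter.1 hi).2
    _ = d v := Finset.card_range _

open scoped Classical in
theorem countP_not_adj_le {V : Type*} [Fintype V] {G : SimpleGraph V} {Z : List V}
    (hZ : Z.Nodup) {v : V} (hv : v ∉ Z) :
    Z.countP (fun z => ¬ G.Adj v z) + G.degree v + 1 ≤ Fintype.card V := by
  rw [List.countP_eq_length_filter, ← List.toFinset_card_of_nodup (hZ.filter _),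
    ← card_neighborFinset_eq_degree, add_assoc,
    ← Finset.card_insert_of_notMem (G.notMem_neighborFinset_self v), ← Finset.card_union_of_disjoint]
  · exact Finset.card_le_univ _
  · rw [Finset.disjoint_left]
    intro x hx hx'
    simp only [List.toFinset_filter, Finset.mem_filter, List.mem_toFinset,
      decide_eq_true_eq] at hx
    rw [Finset.mem_insert, mem_neighborFinset] at hx'
    rcases hx' with rfl | h
    · exact hv hx.1
    · exact hx.2 h

open scoped Classical in
/-- A rooted tree whose vertices outside a path have at most one child embeds in a graph with a
Hamiltonian cycle and small total deficiency; `pos` is the position along the path. -/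
theorem exists_embedding_of_isHamSeq {V W : Type*} [Fintype V] [Fintype W] {G : SimpleGraph V}
    {q : ℕ → V} (hq : IsHamSeq G q) {k : ℕ} {d : V → ℕ} (hd : ∀ v, G.degree v + d v + 1 = k)
    (hsum : ∑ v, d v < Fintype.card V) (hW : Fintype.card W = k) (hkn : k ≤ Fintype.card V)
    {T : SimpleGraph W} {r : W} (R : Rooting T r) (S : Finset W) (pos : W → ℕ) (hr : r ∈ S)
    (hpar : ∀ a ∈ S, a ≠ r → R.par a ∈ S) (hinj : Set.InjOn pos S)
    (hpos : ∀ a ∈ S, pos a < S.card)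
    (hstep : ∀ a ∈ S, a ≠ r → pos a = pos (R.par a) + 1 ∨ pos (R.par a) = pos a + 1)
    (hone : ∀ b c, b ≠ r → c ≠ r → R.par b = R.par c → R.par b ∉ S → b = c) :
    ∃ f : W → V, Function.Injective f ∧ ∀ a, a ≠ r → G.Adj (f a) (f (R.par a)) := by
  have hSk : S.card ≤ k := hW ▸ Finset.card_le_univ S
  let Y := Finset.univ.filter fun y => y ∉ S ∧ R.par y ∈ S
  have hY : ∀ y, y ∈ Y.toList ↔ y ∉ S ∧ R.par y ∈ S := by simp [Y]
  obtain ⟨θ, hθ, hgr⟩ : ∃ θ < Fintype.card V,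
      GradedBy (fun y => d (rotateSeq (Fintype.card V) q θ (pos (R.par y)))) 0 Y.toList := by
    by_contra! hc
    have h1 := card_not_gradedBy_le hq.1 d (fun y => pos (R.par y)) Y.toList (fun y hy => by
      have := hpos _ ((hY y).1 hy).2
      omega)
    rw [Finset.filter_true_of_mem (by simpa using hc), Finset.card_range] at h1
    have := sum_card_lt_le_sum d Y.toList.length
    omega
  have hq' := hq.rotate hθ
  generalize rotateSeq (Fintype.card V) q θ = p at hgr hq'
  have hpinj : ∀ i j, i < Fintype.card V → j < Fintype.card V → p i = p j → i = j :=
    fun i j hi hj h => hq'.1 hi hj h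
  let Z := (List.range (Fintype.card V - S.card)).map fun i => p (S.card + i)
  have hZnd : Z.Nodup := by
    apply List.Nodup.map_on _ List.nodup_range
    intro i hi j hj h
    rw [List.mem_range] at hi hj
    have := hpinj _ _ (by omega) (by omega) h
    omega
  have hZS : ∀ z ∈ Z, ∀ a ∈ S, p (pos a) ≠ z := by
    intro z hz a ha h
    obtain ⟨i, hi, rfl⟩ := List.mem_map.1 hz
    rw [List.mem_range] at hi
    have h1 := hpos a ha
    have := hpinj _ _ (by omega) (by omega) h
    omega
  have hext : PathExtension G R S (fun a => p (pos a)) Z := by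
    refine ⟨hr, hpar, hone, ?_, ?_, hZnd, hZS, ?_⟩
    · intro a ha b hb hab
      have h1 := hpos a ha
      have h2 := hpos b hb
      exact hinj ha hb (hpinj _ _ (by omega) (by omega) hab)
    · intro a ha har
      have h1 := hpos a ha
      have h2 := hpos _ (hpar a ha har)
      rcases hstep a ha har with h | h
      · rw [h]
        exact (hq'.2.1 _ (by omega)).symm
      · rw [h]
        exact hq'.2.1 _ (by omega)
    · rw [List.isChain_map, List.isChain_iff_getElem]
      intro i hi
      simp only [List.length_range, List.getElem_range] at hi ⊢
      exact hq'.2.1 _ (by omega)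
  refine hext.exists_embedding Z S _ Y.toList none (Fintype.card V - k) ?_ Y.nodup_toList
    (fun y hy => (hY y).1 hy) (by simp) (fun y h1 h2 => Or.inl ((hY y).2 ⟨h1, h2⟩)) ?_
  · simp only [Z, List.length_map, List.length_range]
    omega
  · apply hgr.mono
    intro y hy
    have h1 := countP_not_adj_le (G := G) hZnd (v := p (pos (R.par y)))
      (fun h => hZS _ h _ ((hY y).1 hy).2 rfl)
    have h2 := hd (p (pos (R.par y)))
    omega

open scoped Classical in
theorem degree_induce_ne_add {V : Type*} [Fintype V] (G : SimpleGraph V) (v : V)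
    (x : {x | x ≠ v}) :
    (G.induce {x | x ≠ v}).degree x + (if G.Adj v x then 1 else 0) = G.degree x := by
  have h : ((G.induce {x | x ≠ v}).neighborFinset x).map (Function.Embedding.subtype _) =
      (G.neighborFinset x).erase v := by
    ext y
    simp only [Finset.mem_map, mem_neighborFinset, comap_adj, Function.Embedding.subtype_apply,
      Finset.mem_erase]
    constructor
    · rintro ⟨z, hz, rfl⟩
      exact ⟨z.2, hz⟩
    · rintro ⟨h1, h2⟩
      exact ⟨⟨y, h1⟩, h2, rfl⟩
  have h2 := congrArg Finset.card h
  rw [Finset.card_map, card_neighborFinset_eq_degree] at h2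
  rw [h2]
  split_ifs with hv
  · rw [Finset.card_erase_add_one (by simpa using hv.symm), card_neighborFinset_eq_degree]
  · rw [Finset.erase_eq_of_notMem (by simpa using fun h => hv h.symm),
      card_neighborFinset_eq_degree, add_zero]

open scoped Classical in
/-- The total deficiency of a graph stays small when a vertex of large deficiency is deleted. -/
theorem sum_deficiency_induce_ne {V : Type*} [Fintype V] {G : SimpleGraph V} {k : ℕ} {d : V → ℕ}
    (hd : ∀ v, G.degree v + d v + 1 = k) (hsum : ∑ v, d v < Fintype.card V) {v : V}
    (hv : k ≤ 2 * d v) :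
    ∃ d' : {x | x ≠ v} → ℕ, (∀ x, (G.induce {x | x ≠ v}).degree x + d' x + 1 = k) ∧
      ∑ x, d' x < Fintype.card {x | x ≠ v} := by
  refine ⟨fun x => d x + (if G.Adj v x then 1 else 0), ?_, ?_⟩
  · intro x
    have := degree_induce_ne_add G v x
    have := hd x
    dsimp only
    omega
  · have h1 : ∑ x : {x | x ≠ v}, (d x + if G.Adj v x then 1 else 0) =
        ∑ x ∈ Finset.univ.erase v, (d x + if G.Adj v x then 1 else 0) := by
      rw [Finset.sum_subtype (Finset.univ.erase v) (p := fun x => x ∈ {x | x ≠ v}) (by simp)]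
    have h2 := Finset.sum_erase_add Finset.univ (fun x => d x + if G.Adj v x then 1 else 0)
      (Finset.mem_univ v)
    have h3 : ∑ x, (if G.Adj v x then 1 else 0) = G.degree v := by
      rw [← Finset.card_filter, ← card_neighborFinset_eq_degree, neighborFinset_eq_filter]
    rw [Finset.sum_add_distrib (s := Finset.univ), h3] at h2
    simp only [SimpleGraph.irrefl, if_false, add_zero] at h2
    have h4 : Fintype.card {x | x ≠ v} = Fintype.card V - 1 := Set.card_ne_eq v
    have := hd v
    refine h1.trans_lt ?_
    omega

open scoped Classical in
theorem exists_embedding_of_path {k : ℕ} (hk : 9 ≤ k) {W : Type*} [Fintype W]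
    (hW : Fintype.card W = k) {T : SimpleGraph W} {r : W} (R : Rooting T r) (S : Finset W)
    (pos : W → ℕ) (hr : r ∈ S)
    (hpar : ∀ a ∈ S, a ≠ r → R.par a ∈ S) (hinj : Set.InjOn pos S)
    (hpos : ∀ a ∈ S, pos a < S.card)
    (hstep : ∀ a ∈ S, a ≠ r → pos a = pos (R.par a) + 1 ∨ pos (R.par a) = pos a + 1)
    (hone : ∀ b c, b ≠ r → c ≠ r → R.par b = R.par c → R.par b ∉ S → b = c) (n : ℕ) :
    ∀ (V : Type*) [Fintype V] (G : SimpleGraph V) (d : V → ℕ), Fintype.card V = n →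
    n ≤ k + 4 → (∀ v, G.degree v + d v + 1 = k) → ∑ v, d v < Fintype.card V →
    ∃ f : W → V, Function.Injective f ∧ ∀ a, a ≠ r → G.Adj (f a) (f (R.par a)) := by
  induction n with
  | zero =>
    intro V _ G d hn _ _ hsum
    omega
  | succ n ih =>
    intro V _ G d hn hnk hd hsum
    by_cases hbig : ∃ v, k ≤ 2 * d v
    · obtain ⟨v, hv⟩ := hbig
      obtain ⟨d', hd', hsum'⟩ := sum_deficiency_induce_ne hd hsum hv
      obtain ⟨f, hf, hadj⟩ := ih {x | x ≠ v} (G.induce {x | x ≠ v}) d' (by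
        rw [Set.card_ne_eq v, hn, Nat.add_sub_cancel]) (by omega) hd' hsum'
      exact ⟨fun a => f a, fun a b h => hf (Subtype.ext h), fun a ha => hadj a ha⟩
    · push Not at hbig
      have hkn : k ≤ Fintype.card V := by
        by_contra! hc
        have h1 : ∀ v ∈ Finset.univ, 1 ≤ d v := by
          intro v _
          have := G.degree_lt_card_verts v
          have := hd v
          omega
        have : Finset.univ.card • 1 ≤ ∑ v, d v := Finset.card_nsmul_le_sum _ _ _ h1
        simp only [Finset.card_univ, smul_eq_mul, mul_one] at this
        omega
      obtain ⟨q, hq⟩ := exists_isHamSeq_of_deficiency hk hd hsum (by omega) hkn hbig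
      exact exists_embedding_of_isHamSeq hq hd hsum hW hkn R S pos hr hpar hinj hpos hstep hone

namespace Rooting
variable {W : Type*} {T : SimpleGraph W} {r : W} (R : Rooting T r)

theorem eq_root_of_dep_eq_zero {a : W} (h : R.dep a = 0) : a = r := by
  by_contra ha
  have := R.dep_pos ha
  omega

theorem dep_iterate {x : W} {i : ℕ} (hi : i ≤ R.dep x) : R.dep (R.par^[i] x) + i = R.dep x := by
  induction i with
  | zero => simp
  | succ i ih =>
    have h1 := ih (by omega)
    have hne : R.par^[i] x ≠ r := by
      intro h
      rw [h, R.dep_root] at h1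
      omega
    have := R.dep_par _ hne
    rw [Function.iterate_succ_apply']
    omega

open scoped Classical in
/-- The vertices on the path from `x` to the root. -/
noncomputable def anc (x : W) : Finset W :=
  (Finset.range (R.dep x + 1)).image fun i => R.par^[i] x

theorem mem_anc {x a : W} : a ∈ R.anc x ↔ ∃ i ≤ R.dep x, R.par^[i] x = a := by
  simp [anc]

theorem mem_anc_self (x : W) : x ∈ R.anc x := R.mem_anc.2 ⟨0, by omega, rfl⟩

theorem dep_le_of_mem_anc {x a : W} (h : a ∈ R.anc x) : R.dep a ≤ R.dep x := by
  obtain ⟨i, hi, rfl⟩ := R.mem_anc.1 h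
  have := R.dep_iterate hi
  omega

theorem root_mem_anc (x : W) : r ∈ R.anc x := by
  refine R.mem_anc.2 ⟨R.dep x, le_rfl, R.eq_root_of_dep_eq_zero ?_⟩
  have := R.dep_iterate (x := x) le_rfl
  omega

theorem par_mem_anc {x a : W} (h : a ∈ R.anc x) (ha : a ≠ r) : R.par a ∈ R.anc x := by
  obtain ⟨i, hi, rfl⟩ := R.mem_anc.1 h
  have := R.dep_iterate hi
  have := R.dep_pos ha
  exact R.mem_anc.2 ⟨i + 1, by omega, Function.iterate_succ_apply' _ _ _⟩

theorem eq_of_mem_anc {x a b : W} (ha : a ∈ R.anc x) (hb : b ∈ R.anc x)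
    (h : R.dep a = R.dep b) : a = b := by
  obtain ⟨i, hi, rfl⟩ := R.mem_anc.1 ha
  obtain ⟨j, hj, rfl⟩ := R.mem_anc.1 hb
  have h1 := R.dep_iterate hi
  have h2 := R.dep_iterate hj
  have : i = j := by omega
  rw [this]

theorem card_anc (x : W) : (R.anc x).card = R.dep x + 1 := by
  classical
  rw [anc, Finset.card_image_of_injOn, Finset.card_range]
  intro i hi j hj hij
  simp only [Finset.coe_range, Set.mem_Iio] at hi hj
  have h1 := R.dep_iterate (x := x) (i := i) (by omega)
  have h2 := R.dep_iterate (x := x) (i := j) (by omega)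
  dsimp only at hij
  rw [hij] at h1
  omega

theorem exists_child_mem_anc {x m : W} (hm : m ∈ R.anc x) (hne : m ≠ x) :
    ∃ c ∈ R.anc x, c ≠ r ∧ R.par c = m := by
  obtain ⟨i, hi, rfl⟩ := R.mem_anc.1 hm
  cases i with
  | zero => exact absurd rfl hne
  | succ i =>
    refine ⟨_, R.mem_anc.2 ⟨i, by omega, rfl⟩, ?_, (Function.iterate_succ_apply' _ _ _).symm⟩
    intro h
    have := R.dep_iterate (x := x) (i := i) (by omega)
    rw [h, R.dep_root] at this
    omega

open scoped Classical in
/-- The union of two paths from the root that only share the root is a path. -/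
theorem exists_pos_of_anc_inter {x z : W} (h : ∀ m ∈ R.anc x, m ∈ R.anc z → m = r) :
    ∃ pos : W → ℕ, Set.InjOn pos (R.anc x ∪ R.anc z : Finset W) ∧
      (∀ a ∈ R.anc x ∪ R.anc z, pos a < (R.anc x ∪ R.anc z).card) ∧
      ∀ a ∈ R.anc x ∪ R.anc z, a ≠ r → pos a = pos (R.par a) + 1 ∨ pos (R.par a) = pos a + 1 := by
  have hcard : (R.anc x ∪ R.anc z).card = R.dep x + R.dep z + 1 := by
    have h1 := Finset.card_union_add_card_inter (R.anc x) (R.anc z)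
    have h2 : R.anc x ∩ R.anc z = {r} := by
      ext m
      simp only [Finset.mem_inter, Finset.mem_singleton]
      exact ⟨fun hm => h m hm.1 hm.2, by
        rintro hm
        rw [hm]
        exact ⟨R.root_mem_anc x, R.root_mem_anc z⟩⟩
    rw [h2, Finset.card_singleton, R.card_anc, R.card_anc] at h1
    omega
  let pos : W → ℕ := fun a => if a ∈ R.anc x then R.dep z + R.dep a else R.dep z - R.dep a
  have hx : ∀ a ∈ R.anc x, pos a = R.dep z + R.dep a := fun a ha => if_pos ha
  have hz : ∀ a ∈ R.anc z, pos a = R.dep z - R.dep a := by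
    intro a ha
    by_cases hax : a ∈ R.anc x
    · rw [hx a hax, h a hax ha, R.dep_root]
      omega
    · exact if_neg hax
  have hpos : ∀ a ∈ R.anc z, a ≠ r → 0 < R.dep a := fun a _ ha => R.dep_pos ha
  refine ⟨pos, ?_, ?_, ?_⟩
  · intro a ha b hb hab
    simp only [Finset.coe_union, Set.mem_union, Finset.mem_coe] at ha hb
    have mixed : ∀ a b, a ∈ R.anc x → b ∈ R.anc z → pos a = pos b → a = b := by
      intro a b ha hb hab
      rw [hx a ha, hz b hb] at hab
      have := R.dep_le_of_mem_anc hb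
      rw [R.eq_root_of_dep_eq_zero (a := a) (by omega), R.eq_root_of_dep_eq_zero (a := b) (by omega)]
    rcases ha with ha | ha <;> rcases hb with hb | hb
    · rw [hx a ha, hx b hb] at hab
      exact R.eq_of_mem_anc ha hb (by omega)
    · exact mixed a b ha hb hab
    · exact (mixed b a hb ha hab.symm).symm
    · rw [hz a ha, hz b hb] at hab
      have := R.dep_le_of_mem_anc ha
      have := R.dep_le_of_mem_anc hb
      exact R.eq_of_mem_anc ha hb (by omega)
  · intro a ha
    rcases Finset.mem_union.1 ha with ha | ha
    · have := R.dep_le_of_mem_anc ha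
      rw [hx a ha]
      omega
    · rw [hz a ha]
      omega
  · intro a ha har
    have h1 := R.dep_par a har
    rcases Finset.mem_union.1 ha with ha | ha
    · rw [hx a ha, hx _ (R.par_mem_anc ha har)]
      omega
    · have := R.dep_le_of_mem_anc ha
      rw [hz a ha, hz _ (R.par_mem_anc ha har)]
      omega

end Rooting

open scoped Classical in
/-- If a tree has at most three branch vertices, they lie on a common path. -/
theorem SimpleGraph.IsTree.exists_path_cover {W : Type*} [Fintype W] [Nonempty W]
    {T : SimpleGraph W} (hT : T.IsTree)
    (hbr : (Finset.univ.filter fun v => 3 ≤ T.degree v).card ≤ 3) :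
    ∃ (r : W) (R : Rooting T r) (S : Finset W) (pos : W → ℕ), r ∈ S ∧
      (∀ a ∈ S, a ≠ r → R.par a ∈ S) ∧ Set.InjOn pos S ∧ (∀ a ∈ S, pos a < S.card) ∧
      (∀ a ∈ S, a ≠ r → pos a = pos (R.par a) + 1 ∨ pos (R.par a) = pos a + 1) ∧
      ∀ a, 3 ≤ T.degree a → a ∈ S := by
  obtain ⟨y, x, z, hyxz⟩ : ∃ y x z : W, ∀ a, 3 ≤ T.degree a → a = y ∨ a = x ∨ a = z := by
    obtain ⟨w⟩ := ‹Nonempty W›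
    suffices h : ∃ y x z : W, ∀ a ∈ Finset.univ.filter fun v => 3 ≤ T.degree v,
        a = y ∨ a = x ∨ a = z by simpa using h
    generalize (Finset.univ.filter fun v => 3 ≤ T.degree v) = B at hbr
    interval_cases hB : B.card
    · rw [Finset.card_eq_zero] at hB
      exact ⟨w, w, w, by simp [hB]⟩
    · obtain ⟨a, rfl⟩ := Finset.card_eq_one.1 hB
      exact ⟨a, a, a, by simp⟩
    · obtain ⟨a, b, -, rfl⟩ := Finset.card_eq_two.1 hB
      exact ⟨a, b, b, by simp⟩
    · obtain ⟨a, b, c, -, -, -, rfl⟩ := Finset.card_eq_three.1 hB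
      exact ⟨a, b, c, by simp⟩
  obtain ⟨R⟩ := hT.nonempty_rooting y
  have main : ∀ x' z', (∀ m ∈ R.anc x', m ∈ R.anc z' → m = y) →
      (x ∈ R.anc x' ∨ x ∈ R.anc z') → (z ∈ R.anc x' ∨ z ∈ R.anc z') →
      ∃ (r : W) (R : Rooting T r) (S : Finset W) (pos : W → ℕ), r ∈ S ∧
      (∀ a ∈ S, a ≠ r → R.par a ∈ S) ∧ Set.InjOn pos S ∧ (∀ a ∈ S, pos a < S.card) ∧
      (∀ a ∈ S, a ≠ r → pos a = pos (R.par a) + 1 ∨ pos (R.par a) = pos a + 1) ∧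
      ∀ a, 3 ≤ T.degree a → a ∈ S := by
    intro x' z' h hx hz
    obtain ⟨pos, h1, h2, h3⟩ := R.exists_pos_of_anc_inter h
    refine ⟨y, R, R.anc x' ∪ R.anc z', pos, by simp [R.root_mem_anc], ?_, h1, h2, h3, ?_⟩
    · intro a ha har
      rw [Finset.mem_union] at ha ⊢
      exact ha.imp (fun h => R.par_mem_anc h har) fun h => R.par_mem_anc h har
    · intro a ha
      rw [Finset.mem_union]
      rcases hyxz a ha with rfl | rfl | rfl
      · exact Or.inl (R.root_mem_anc _)
      · exact hx
      · exact hz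
  have hroot : ∀ m ∈ R.anc y, m = y := by
    intro m hm
    have := R.dep_le_of_mem_anc hm
    rw [R.dep_root] at this
    exact R.eq_root_of_dep_eq_zero (by omega)
  by_cases hcom : ∀ m ∈ R.anc x, m ∈ R.anc z → m = y
  · exact main x z hcom (Or.inl (R.mem_anc_self x)) (Or.inr (R.mem_anc_self z))
  push Not at hcom
  obtain ⟨m₀, hm₀x, hm₀z, hm₀y⟩ := hcom
  obtain ⟨m, hm, hmax⟩ := (R.anc x ∩ R.anc z).exists_max_image R.dep
    ⟨m₀, Finset.mem_inter.2 ⟨hm₀x, hm₀z⟩⟩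
  obtain ⟨hmx, hmz⟩ := Finset.mem_inter.1 hm
  have hmy : m ≠ y := by
    rintro rfl
    have := hmax m₀ (Finset.mem_inter.2 ⟨hm₀x, hm₀z⟩)
    have := R.dep_pos hm₀y
    rw [R.dep_root] at *
    omega
  by_cases hmx' : m = x
  · exact main y z (fun m hm _ => hroot m hm) (Or.inr (hmx' ▸ hmz)) (Or.inr (R.mem_anc_self z))
  by_cases hmz' : m = z
  · exact main x y (fun m _ hm => hroot m hm) (Or.inl (R.mem_anc_self x)) (Or.inl (hmz' ▸ hmx))
  obtain ⟨c, hcx, hcr, hc⟩ := R.exists_child_mem_anc hmx hmx'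
  obtain ⟨c', hcz, hcr', hc'⟩ := R.exists_child_mem_anc hmz hmz'
  have hcc : c ≠ c' := by
    rintro rfl
    have h1 := hmax c (Finset.mem_inter.2 ⟨hcx, hcz⟩)
    have h2 := R.dep_par c hcr
    rw [hc] at h2
    omega
  rcases hyxz m (R.three_le_degree hmy hcr hcr' hcc hc hc') with h | h | h
  · exact absurd h hmy
  · exact absurd h hmx'
  · exact absurd h hmz'

open scoped Classical in
theorem exists_embedding_of_few_branch {V W : Type*} [Fintype V] [Fintype W] {k : ℕ}
    (hk : 9 ≤ k) {G : SimpleGraph V} {d : V → ℕ} (hn : Fintype.card V ≤ k + 4)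
    (hd : ∀ v, G.degree v + d v + 1 = k) (hsum : ∑ v, d v < Fintype.card V)
    (hW : Fintype.card W = k) {T : SimpleGraph W} (hT : T.IsTree)
    (hbr : (Finset.univ.filter fun v => 3 ≤ T.degree v).card ≤ 3) :
    ∃ f : W → V, Function.Injective f ∧ ∀ a b, T.Adj a b → G.Adj (f a) (f b) := by
  have : Nonempty W := Fintype.card_pos_iff.1 (by omega)
  obtain ⟨r, R, S, pos, h1, h2, h3, h4, h5, h6⟩ := hT.exists_path_cover hbr
  obtain ⟨f, hf, hadj⟩ := exists_embedding_of_path hk hW R S pos h1 h2 h3 h4 h5 (by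
    intro b c hb hc hbc hS
    by_contra hne
    exact hS (h6 _ (R.three_le_degree (by rintro h; rw [h] at hS; exact hS h1) hb hc hne rfl hbc.symm))) _ V G d rfl
    hn hd hsum
  refine ⟨f, hf, fun a b hab => ?_⟩
  rcases R.adj_cases a b hab with ⟨ha, rfl⟩ | ⟨hb, rfl⟩
  · exact hadj a ha
  · exact (hadj b hb).symm

/-- `f` embeds the subgraph of `T` induced on `A` into `G`, with the value of `d` at `f a` at
most `c a`. -/
structure CapEmbedding {V W : Type*} (T : SimpleGraph W) (G : SimpleGraph V) (d : V → ℕ)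
    (c : W → ℕ) (A : Finset W) (f : W → V) : Prop where
  injOn : Set.InjOn f A
  adj : ∀ a ∈ A, ∀ b ∈ A, T.Adj a b → G.Adj (f a) (f b)
  cap : ∀ a ∈ A, d (f a) ≤ c a

section Greedy
variable {V W : Type*} {G : SimpleGraph V} {T : SimpleGraph W}
  {k : ℕ} {d : V → ℕ} {c : W → ℕ} {A B : Finset W} {f : W → V}

theorem CapEmbedding.empty (f : W → V) : CapEmbedding T G d c ∅ f := by
  constructor <;> simp

open scoped Classical in
theorem sum_filter_adj_le {U : Finset W} {t p : W} (h : ∀ s ∈ U, T.Adj t s → s = p) :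
    ∑ s ∈ U.filter (T.Adj t), (4 + c s) ≤ 4 + c p := by
  rw [← Finset.sum_singleton (fun s => 4 + c s) p]
  apply Finset.sum_le_sum_of_subset
  intro s hs
  rw [Finset.mem_filter] at hs
  rw [Finset.mem_singleton]
  exact h s hs.1 hs.2

open scoped Classical in
theorem sum_filter_adj_eq_zero {U : Finset W} {t : W} (h : ∀ s ∈ U, ¬ T.Adj t s) :
    ∑ s ∈ U.filter (T.Adj t), (4 + c s) = 0 := by
  rw [Finset.filter_false_of_mem h, Finset.sum_empty]

theorem card_add_one_le_of_notMem {U : Finset W} {t : W} (hU : U ⊆ B) (ht : t ∈ B)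
    (htU : t ∉ U) : U.card + 1 ≤ B.card := by
  classical
  rw [← Finset.card_insert_of_notMem htU]
  exact Finset.card_le_card (Finset.insert_subset ht hU)

open scoped Classical in
theorem sum_filter_adj_le_of_degree [Fintype W] {U : Finset W} {t : W} {m : ℕ}
    (h : ∀ s ∈ U, T.Adj t s → c s ≤ m) :
    ∑ s ∈ U.filter (T.Adj t), (4 + c s) ≤ T.degree t * (4 + m) := by
  refine (Finset.sum_le_card_nsmul _ _ (4 + m) ?_).trans ?_
  · intro s hs
    rw [Finset.mem_filter] at hs
    have := h s hs.1 hs.2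
    omega
  · rw [smul_eq_mul, ← card_neighborFinset_eq_degree]
    apply Nat.mul_le_mul_right
    apply Finset.card_le_card
    intro s hs
    simpa using (Finset.mem_filter.1 hs).2

variable [Fintype V]

open scoped Classical in
theorem CapEmbedding.exists_insert (hn : Fintype.card V = k + 4)
    (hd : ∀ v, G.degree v + d v + 1 = k) (h : CapEmbedding T G d c A f) {t : W} (ht : t ∉ A)
    (hcount : A.card + (Finset.univ.filter fun v => c t < d v).card +
      ∑ s ∈ A.filter (T.Adj t), (4 + c s) < k + 4) :
    ∃ v, CapEmbedding T G d c (insert t A) (Function.update f t v) := by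
  let N : V → Finset V := fun w => (insert w (G.neighborFinset w))ᶜ
  have hN : ∀ w, (N w).card = 4 + d w := by
    intro w
    have := hd w
    simp only [N]
    rw [Finset.card_compl, Finset.card_insert_of_notMem (G.notMem_neighborFinset_self w),
      card_neighborFinset_eq_degree]
    omega
  obtain ⟨v, hv⟩ : ∃ v, v ∉ (A.image f ∪ Finset.univ.filter fun v => c t < d v) ∪
      (A.filter (T.Adj t)).biUnion fun s => N (f s) := by
    by_contra! hall
    have h1 : Fintype.card V ≤ _ := Finset.card_le_card (fun v _ => hall v)
    have h2 := Finset.card_union_le (A.image f ∪ Finset.univ.filter fun v => c t < d v)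
      ((A.filter (T.Adj t)).biUnion fun s => N (f s))
    have h3 := Finset.card_union_le (A.image f) (Finset.univ.filter fun v => c t < d v)
    have h4 := Finset.card_image_le (s := A) (f := f)
    have h5 : ((A.filter (T.Adj t)).biUnion fun s => N (f s)).card ≤
        ∑ s ∈ A.filter (T.Adj t), (4 + c s) := by
      refine Finset.card_biUnion_le.trans (Finset.sum_le_sum fun s hs => ?_)
      rw [hN]
      have := h.cap s (Finset.mem_filter.1 hs).1
      omega
    omega
  simp only [Finset.mem_union, Finset.mem_image, Finset.mem_filter, Finset.mem_univ, true_and,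
    Finset.mem_biUnion, not_or, not_exists, not_and, not_lt, N, Finset.mem_compl, not_not,
    Finset.mem_insert, mem_neighborFinset] at hv
  obtain ⟨⟨hvA, hvc⟩, hvadj⟩ := hv
  have hup : ∀ a ∈ A, Function.update f t v a = f a := fun a ha =>
    Function.update_of_ne (by rintro rfl; exact ht ha) _ _
  have hadj : ∀ s ∈ A, T.Adj t s → G.Adj (f s) v := fun s hs hts =>
    hvadj s ⟨hs, hts⟩ fun h' => hvA s hs h'.symm
  refine ⟨v, ?_, ?_, ?_⟩
  · intro a ha b hb hab
    simp only [Finset.coe_insert, Set.mem_insert_iff, Finset.mem_coe] at ha hb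
    rcases ha with rfl | ha <;> rcases hb with rfl | hb
    · rfl
    · rw [hup b hb, Function.update_self] at hab
      exact absurd hab.symm (hvA b hb)
    · rw [hup a ha, Function.update_self] at hab
      exact absurd hab (hvA a ha)
    · rw [hup a ha, hup b hb] at hab
      exact h.injOn ha hb hab
  · intro a ha b hb hab
    rcases Finset.mem_insert.1 ha with ha' | ha' <;> rcases Finset.mem_insert.1 hb with hb' | hb'
    · subst ha' hb'
      exact absurd hab (T.irrefl)
    · subst ha'
      rw [hup b hb', Function.update_self]
      exact (hadj b hb' hab).symm
    · subst hb'
      rw [hup a ha', Function.update_self]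
      exact hadj a ha' hab.symm
    · rw [hup a ha', hup b hb']
      exact h.adj a ha' b hb' hab
  · intro a ha
    rcases Finset.mem_insert.1 ha with rfl | ha
    · rw [Function.update_self]
      exact hvc
    · rw [hup a ha]
      exact h.cap a ha

open scoped Classical in
/-- Greedy extension of an embedding from `A` to `B`, in the order given by `ρ`. -/
theorem CapEmbedding.extend {ι : Type*} [LinearOrder ι] (hn : Fintype.card V = k + 4)
    (hd : ∀ v, G.degree v + d v + 1 = k) (h : CapEmbedding T G d c A f) (hAB : A ⊆ B) (ρ : W → ι)
    (hcount : ∀ t ∈ B, t ∉ A → ∀ U ⊆ B, t ∉ U → (∀ s ∈ U, s ∈ A ∨ ρ s ≤ ρ t) →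
      U.card + (Finset.univ.filter fun v => c t < d v).card +
      ∑ s ∈ U.filter (T.Adj t), (4 + c s) < k + 4) :
    ∃ f, CapEmbedding T G d c B f := by
  suffices key : ∀ m, ∀ U f, A ⊆ U → U ⊆ B → (B \ U).card = m →
      (∀ s ∈ U, s ∈ A ∨ ∀ t ∈ B \ U, ρ s ≤ ρ t) → CapEmbedding T G d c U f →
      ∃ f, CapEmbedding T G d c B f from
    key _ A f subset_rfl hAB rfl (fun s hs => Or.inl hs) h
  intro m
  induction m with
  | zero =>
    intro U f _ hUB hcard _ hf
    rw [Finset.card_eq_zero, Finset.sdiff_eq_empty_iff_subset] at hcard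
    exact ⟨f, Finset.Subset.antisymm hcard hUB ▸ hf⟩
  | succ m ih =>
    intro U f hAU hUB hcard hU hf
    obtain ⟨t, ht, hmin⟩ := (B \ U).exists_min_image ρ (Finset.card_pos.1 (by omega))
    obtain ⟨htB, htU⟩ := Finset.mem_sdiff.1 ht
    obtain ⟨v, hv⟩ := hf.exists_insert hn hd htU (hcount t htB (fun h => htU (hAU h)) U hUB htU
      fun s hs => (hU s hs).imp_right fun h => h t ht)
    refine ih _ _ (hAU.trans (Finset.subset_insert _ _)) (Finset.insert_subset htB hUB) ?_ ?_ hv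
    · rw [Finset.sdiff_insert, Finset.card_erase_of_mem ht]
      omega
    · have hsub : ∀ x ∈ B \ insert t U, x ∈ B \ U := by
        intro x hx
        simp only [Finset.mem_sdiff, Finset.mem_insert, not_or] at hx ⊢
        tauto
      intro s hs
      rcases Finset.mem_insert.1 hs with rfl | hs
      · exact Or.inr fun x hx => hmin x (hsub x hx)
      · exact (hU s hs).imp_right fun h x hx => h x (hsub x hx)

open scoped Classical in
theorem card_filter_lt_eq_zero (hd : ∀ v, G.degree v + d v + 1 = k) {m : ℕ} (hm : k ≤ m) :
    (Finset.univ.filter fun v => m < d v).card = 0 := by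
  rw [Finset.card_eq_zero, Finset.filter_false_of_mem]
  intro v _
  have := hd v
  omega

open scoped Classical in
/-- Extension of an embedding of the internal vertices of a tree to the leaves: the leaves
attached to a vertex with larger cap are embedded first. -/
theorem CapEmbedding.extend_leaves [Fintype W] (hn : Fintype.card V = k + 4) (hW : Fintype.card W = k)
    (hd : ∀ v, G.degree v + d v + 1 = k) (h : CapEmbedding T G d c A f) {par : W → W}
    (hpar : ∀ t, t ∉ A → ∀ s, T.Adj t s → s = par t)
    (hc : ∀ t, t ∉ A → k ≤ c t)
    (hcond : ∀ t, t ∉ A → c (par t) ≤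
      (Finset.univ.filter fun s => s ∉ A ∧ c (par s) < c (par t)).card) :
    ∃ f : W → V, Function.Injective f ∧ ∀ a b, T.Adj a b → G.Adj (f a) (f b) := by
  obtain ⟨f, hf⟩ := h.extend (B := Finset.univ) hn hd (Finset.subset_univ _)
    (fun t => OrderDual.toDual (c (par t))) (by
    intro t _ htA U _ htU hU
    rw [card_filter_lt_eq_zero hd (hc t htA)]
    have h1 := sum_filter_adj_le (c := c) (U := U) fun s _ hs => hpar t htA s hs
    have h2 := hcond t htA
    have h3 : Disjoint (insert t U) (Finset.univ.filter fun s => s ∉ A ∧ c (par s) < c (par t)) := by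
      rw [Finset.disjoint_left]
      intro s hs hs'
      simp only [Finset.mem_filter, Finset.mem_univ, true_and] at hs'
      rcases Finset.mem_insert.1 hs with rfl | hs
      · omega
      · rcases hU s hs with h | h
        · exact hs'.1 h
        · have := OrderDual.toDual_le_toDual.1 h
          omega
    have h4 := Finset.card_union_of_disjoint h3
    rw [Finset.card_insert_of_notMem htU] at h4
    have h5 := Finset.card_le_univ
      (insert t U ∪ Finset.univ.filter fun s => s ∉ A ∧ c (par s) < c (par t))
    omega)
  exact ⟨f, by simpa using hf.injOn, fun a b => hf.adj a (Finset.mem_univ _) b (Finset.mem_univ _)⟩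

end Greedy

namespace Rooting
variable {W : Type*} [Fintype W] {T : SimpleGraph W} {r : W} (R : Rooting T r)

open scoped Classical in
theorem two_le_degree_par (hr : 2 ≤ T.degree r) {t : W} (ht : t ≠ r) :
    2 ≤ T.degree (R.par t) := by
  by_cases h : R.par t = r
  · rwa [h]
  · exact R.two_le_degree h ht rfl

open scoped Classical in
theorem eq_par_of_adj_leaf (hr : 2 ≤ T.degree r) {t s : W} (ht : ¬ 2 ≤ T.degree t)
    (h : T.Adj t s) : s = R.par t := by
  have htr : t ≠ r := by
    rintro rfl
    exact ht hr
  rcases R.adj_cases t s h with ⟨_, h⟩ | ⟨hs, h⟩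
  · exact h.symm
  · exact absurd (R.two_le_degree htr hs h) ht

end Rooting

open scoped Classical in
theorem exists_embedding_of_few_large_deficiency {V W : Type*} [Fintype V] [Fintype W] {k : ℕ}
    {G : SimpleGraph V} {d : V → ℕ} (hn : Fintype.card V = k + 4)
    (hd : ∀ v, G.degree v + d v + 1 = k) (hsum : ∑ v, d v < Fintype.card V)
    (hW : Fintype.card W = k) {T : SimpleGraph W} {I Q : Finset W}
    (hI : ∀ w, w ∈ I ↔ 2 ≤ T.degree w) (hIk : I.card + 6 ≤ k)
    (hQI : Q ⊆ I) (hQ : ∀ t ∈ Q, T.degree t = 2 ∧ ∀ s, T.Adj t s → s ∈ I ∧ s ∉ Q)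
    (hM : (Finset.univ.filter fun v => 1 < d v).card + I.card + 1 ≤ k + Q.card)
    {a x : W} (R : Rooting T a) (ha : a ∈ I) (hx : x ∉ I) (hax : T.Adj a x) :
    ∃ f : W → V, Function.Injective f ∧ ∀ a b, T.Adj a b → G.Adj (f a) (f b) := by
  have haQ : a ∉ Q := fun h => hx ((hQ a h).2 x hax).1
  have har := (hI a).1 ha
  have hM0 := sum_card_lt_le_sum d 1
  simp only [Finset.sum_range_one] at hM0
  let c : W → ℕ := fun w => if w = a then 0 else if w ∈ I ∧ w ∉ Q then 1 else k
  have hca : c a = 0 := by simp [c]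
  have hc1 : ∀ w, w ∈ I → w ∉ Q → c w ≤ 1 := by
    intro w h1 h2
    simp only [c, h1, h2]
    split_ifs <;> simp_all
  have hcQ : ∀ w ∈ Q, c w = k := by
    intro w hw
    have : w ≠ a := fun h => haQ (h ▸ hw)
    simp [c, this, hw]
  have hcI : ∀ w, w ∉ I → c w = k := by
    intro w hw
    have : w ≠ a := fun h => hw (h ▸ ha)
    simp [c, this, hw]
  have hc1' : ∀ w, w ∈ I → w ∉ Q → w ≠ a → c w = 1 := by
    intro w h1 h2 h3
    simp [c, h1, h2, h3]
  have hne : Nonempty V := Fintype.card_pos_iff.1 (by omega)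
  obtain ⟨v₀⟩ := hne
  have hIQ : (I \ Q).card + Q.card = I.card := Finset.card_sdiff_add_card_eq_card hQI
  obtain ⟨f₁, hf₁⟩ := (CapEmbedding.empty (T := T) (G := G) (d := d) (c := c) fun _ => v₀).extend
    (B := I \ Q) hn hd (Finset.empty_subset _) R.dep (by
    intro t ht _ U hU htU hρ
    have hcard := card_add_one_le_of_notMem hU ht htU
    rw [Finset.mem_sdiff] at ht
    have hρ' : ∀ s ∈ U, R.dep s ≤ R.dep t := fun s hs => (hρ s hs).resolve_left (by simp)
    by_cases hta : t = a
    · subst hta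
      have hU0 : U = ∅ := by
        rw [Finset.eq_empty_iff_forall_notMem]
        intro s hs
        have := hρ' s hs
        rw [R.dep_root] at this
        exact htU (R.eq_root_of_dep_eq_zero (a := s) (by omega) ▸ hs)
      rw [hU0, hca]
      simp only [Finset.card_empty, Finset.filter_empty, Finset.sum_empty]
      omega
    · have hp : ∀ s ∈ U, T.Adj t s → s = R.par t := by
        intro s hs hts
        rcases R.adj_cases t s hts with ⟨_, h⟩ | ⟨h, h'⟩
        · exact h.symm
        · have h1 := R.dep_par s h
          have h2 := hρ' s hs
          rw [h'] at h1
          omega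
      rw [hc1' t ht.1 ht.2 hta]
      have hs : ∑ s ∈ U.filter (T.Adj t), (4 + c s) ≤ 5 := by
        by_cases hpQ : R.par t ∈ U
        · have h1 := sum_filter_adj_le (c := c) hp
          have h2 := Finset.mem_sdiff.1 (hU hpQ)
          have := hc1 _ h2.1 h2.2
          omega
        · rw [sum_filter_adj_eq_zero]
          · omega
          · intro s hs hts
            exact hpQ (hp s hs hts ▸ hs)
      omega)
  obtain ⟨f₂, hf₂⟩ := hf₁.extend (B := I) hn hd Finset.sdiff_subset (fun _ => 0) (by
    intro t ht htQ U hU htU _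
    have hcard := card_add_one_le_of_notMem hU ht htU
    have htQ : t ∈ Q := by
      by_contra h
      exact htQ (Finset.mem_sdiff.2 ⟨ht, h⟩)
    rw [hcQ t htQ, card_filter_lt_eq_zero hd le_rfl]
    have h1 := sum_filter_adj_le_of_degree (c := c) (T := T) (U := U) (t := t) (m := 1) (by
      intro s _ hts
      have := (hQ t htQ).2 s hts
      exact hc1 s this.1 this.2)
    rw [(hQ t htQ).1] at h1
    omega)
  refine hf₂.extend_leaves hn hW hd (par := R.par) ?_ (fun t ht => (hcI t ht).ge) ?_
  · intro t ht s hts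
    exact R.eq_par_of_adj_leaf har (by rwa [← hI]) hts
  · intro t ht
    have hta : t ≠ a := fun h => ht (h ▸ ha)
    have hptI : R.par t ∈ I := (hI _).2 (R.two_le_degree_par har hta)
    have hptQ : R.par t ∉ Q := fun h => ht ((hQ _ h).2 t (R.adj_par t hta).symm).1
    by_cases hpa : R.par t = a
    · rw [hpa, hca]
      exact Nat.zero_le _
    · rw [hc1' _ hptI hptQ hpa, Nat.succ_le_iff, Finset.card_pos]
      refine ⟨x, ?_⟩
      rw [Finset.mem_filter, ← R.eq_par_of_adj_leaf har (by rwa [← hI]) hax.symm, hca]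
      exact ⟨Finset.mem_univ _, hx, one_pos⟩

section Spread
variable {V W : Type*} [Fintype V] {G : SimpleGraph V} {T : SimpleGraph W}
  {k : ℕ} {d : V → ℕ} {c : W → ℕ} {I E B : Finset W} {f : W → V}

open scoped Classical in
theorem Rooting.eq_of_adj_leaf [Fintype W] {r : W} (R : Rooting T r) (hI : ∀ w, w ∈ I ↔ 2 ≤ T.degree w)
    (hr : r ∈ I) {a b x : W} (hx : x ∉ I) (ha : T.Adj a x) (hb : T.Adj b x) : a = b := by
  rw [hI] at hr hx
  rw [R.eq_par_of_adj_leaf hr hx ha.symm, R.eq_par_of_adj_leaf hr hx hb.symm]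

open scoped Classical in
/-- If the internal vertices outside a set `E` of degree-two vertices with a leaf neighbour are
embedded with small caps, then the embedding extends to the whole tree. -/
theorem CapEmbedding.extend_of_degree_two [Fintype W] (hn : Fintype.card V = k + 4)
    (hd : ∀ v, G.degree v + d v + 1 = k) (hW : Fintype.card W = k)
    (hI : ∀ w, w ∈ I ↔ 2 ≤ T.degree w)
    (hM : (Finset.univ.filter fun v => 3 < d v).card + I.card + 3 ≤ k)
    (h : CapEmbedding T G d c (I \ E) f)
    (hE : ∀ t ∈ E, c t = 3 ∧ T.degree t = 2 ∧ ∃ y, y ∉ I ∧ T.Adj t y)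
    (hcI : ∀ t, t ∉ I → c t = k)
    (hc : ∀ w ∈ I, w ∉ E → c w ≤ 2 ∨ ∀ s, T.Adj w s → s ∈ I ∧ s ∉ E)
    {r a b x y : W} (R : Rooting T r) (hr : r ∈ I) (hx : x ∉ I) (hax : T.Adj a x) (hca : c a = 0)
    (hy : y ∉ I) (hby : T.Adj b y) (hcb : c b ≤ 1) (hab : a ≠ b)
    (hz : E.Nonempty → ∃ e z, z ∉ I ∧ T.Adj e z ∧ c e ≤ 2 ∧ e ≠ a ∧ e ≠ b) :
    ∃ f : W → V, Function.Injective f ∧ ∀ a b, T.Adj a b → G.Adj (f a) (f b) := by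
  have hrd := (hI r).1 hr
  have hpar : ∀ t, t ∉ I → ∀ s, T.Adj t s → s = R.par t := fun t ht s hts =>
    R.eq_par_of_adj_leaf hrd (by rwa [← hI]) hts
  obtain ⟨f₂, hf₂⟩ := h.extend (B := I) hn hd Finset.sdiff_subset (fun _ => 0) (by
    intro t ht htE U hU htU _
    have hcard := card_add_one_le_of_notMem hU ht htU
    have htE : t ∈ E := by
      by_contra h
      exact htE (Finset.mem_sdiff.2 ⟨ht, h⟩)
    obtain ⟨hct, htd, y, hy, hty⟩ := hE t htE
    have h1 : ∑ s ∈ U.filter (T.Adj t), (4 + c s) ≤ (U.filter (T.Adj t)).card • 7 := by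
      refine Finset.sum_le_card_nsmul _ _ _ fun s hs => ?_
      rw [Finset.mem_filter] at hs
      by_cases hsE : s ∈ E
      · rw [(hE s hsE).1]
      · rcases hc s (hU hs.1) hsE with h | h
        · omega
        · exact absurd htE (h t hs.2.symm).2
    have h2 : (U.filter (T.Adj t)).card + 1 ≤ 2 := by
      rw [← htd, ← card_neighborFinset_eq_degree, ← Finset.card_insert_of_notMem (a := y)]
      · apply Finset.card_le_card
        intro s hs
        rw [mem_neighborFinset]
        rcases Finset.mem_insert.1 hs with rfl | hs
        · exact hty
        · exact (Finset.mem_filter.1 hs).2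
      · exact fun h => hy (hU (Finset.mem_filter.1 h).1)
    rw [hct]
    rw [smul_eq_mul] at h1
    omega)
  refine hf₂.extend_leaves hn hW hd hpar (fun t ht => (hcI t ht).ge) ?_
  intro t ht
  have htr : t ≠ r := fun h => ht (h ▸ hr)
  have hptI : R.par t ∈ I := (hI _).2 (R.two_le_degree_par hrd htr)
  have hxp := hpar x hx a hax.symm
  have hyp := hpar y hy b hby.symm
  have hxy : x ≠ y := by
    rintro rfl
    exact hab (hxp.trans hyp.symm)
  have hpc : c (R.par t) ≤ 2 ∨ R.par t ∈ E := by
    by_cases hpE : R.par t ∈ E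
    · exact Or.inr hpE
    · rcases hc _ hptI hpE with h | h
      · exact Or.inl h
      · exact absurd (h t (R.adj_par t htr).symm).1 ht
  have hxm : ∀ m, 0 < m → x ∈ Finset.univ.filter fun s => s ∉ I ∧ c (R.par s) < m := by
    intro m hm
    simp [hx, ← hxp, hca, hm]
  have hym : ∀ m, 1 < m → y ∈ Finset.univ.filter fun s => s ∉ I ∧ c (R.par s) < m := by
    intro m hm
    simp only [Finset.mem_filter, Finset.mem_univ, true_and, ← hyp]
    exact ⟨hy, by omega⟩
  rcases hpc with h | h
  · generalize c (R.par t) = m at h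
    interval_cases m
    · exact Nat.zero_le _
    · rw [Nat.succ_le_iff, Finset.card_pos]
      exact ⟨x, hxm 1 (by omega)⟩
    · refine (Finset.card_pair hxy).symm.le.trans (Finset.card_le_card fun s hs => ?_)
      rcases Finset.mem_insert.1 hs with rfl | hs
      · exact hxm 2 (by omega)
      · rw [Finset.mem_singleton.1 hs]
        exact hym 2 (by omega)
  · obtain ⟨e, z, hzI, hez, hce, hea, heb⟩ := hz ⟨_, h⟩
    have hzp := hpar z hzI e hez.symm
    rw [(hE _ h).1]
    have hxz : x ≠ z := by
      rintro rfl
      exact hea (hzp.trans hxp.symm)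
    have hyz : y ≠ z := by
      rintro rfl
      exact heb (hzp.trans hyp.symm)
    have h3 : ({x, y, z} : Finset W).card = 3 := Finset.card_eq_three.2 ⟨x, y, z, hxy, hxz, hyz, rfl⟩
    refine h3.symm.le.trans (Finset.card_le_card fun s hs => ?_)
    simp only [Finset.mem_insert, Finset.mem_singleton] at hs
    rcases hs with rfl | rfl | rfl
    · exact hxm 3 (by omega)
    · exact hym 3 (by omega)
    · simp only [Finset.mem_filter, Finset.mem_univ, true_and, ← hzp]
      exact ⟨hzI, by omega⟩

open scoped Classical in
theorem exists_capEmbedding_of_adj_root (hk : 10 ≤ k) (hn : Fintype.card V = k + 4)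
    (hd : ∀ v, G.degree v + d v + 1 = k)
    (hM0 : (Finset.univ.filter fun v => 0 < d v).card < k + 4)
    (hM1 : (Finset.univ.filter fun v => 1 < d v).card + 3 < k)
    (hM2 : (Finset.univ.filter fun v => 2 < d v).card + B.card + 1 < k)
    {a v b : W} (R : Rooting T a) (hav : T.Adj a v) (haB : ∀ t ∈ B, T.Adj a t → t = v)
    (hba : b ≠ a) (hvb : b = v ∨ T.Adj v b)
    (hca : c a = 0) (hcv : c v = 1) (hcb : c b = 1)
    (hc : ∀ t ∈ B, t ≠ a → t ≠ v → t ≠ b → c t = 2) :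
    ∃ f, CapEmbedding T G d c B f := by
  obtain ⟨v₀⟩ : Nonempty V := Fintype.card_pos_iff.1 (by omega)
  have hva : v ≠ a := hav.ne'
  have hpv : R.par v = a := by
    rcases R.adj_cases a v hav with ⟨h, _⟩ | ⟨_, h⟩
    · exact absurd rfl h
    · exact h
  have hpb : b ≠ v → R.par b = v := by
    intro h
    rcases R.adj_cases v b (hvb.resolve_left h) with ⟨_, h⟩ | ⟨_, h⟩
    · exact absurd (h.symm.trans hpv) hba
    · exact h
  let ρ : W → ℕ := fun w => if w = a then 0 else if w = v then 1 else if w = b then 2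
    else R.dep w + 2
  have hρ0 : ∀ w, ρ w ≤ 0 → w = a := by
    intro w hw
    by_contra h
    simp only [ρ, if_neg h] at hw
    split_ifs at hw <;> omega
  have hρ1 : ∀ w, ρ w ≤ 1 → w = a ∨ w = v := by
    intro w hw
    simp only [ρ] at hw
    split_ifs at hw <;> tauto
  have hρ2 : ∀ w, ρ w ≤ 2 → w = a ∨ w = v ∨ w = b := by
    intro w hw
    simp only [ρ] at hw
    split_ifs at hw with h1 h2 h3
    · tauto
    · tauto
    · tauto
    · exact Or.inl (R.eq_root_of_dep_eq_zero (by omega))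
  refine (CapEmbedding.empty fun _ => v₀).extend hn hd (Finset.empty_subset _) ρ ?_
  intro t ht _ U hU htU hρ
  have hρ' : ∀ s ∈ U, ρ s ≤ ρ t := fun s hs => (hρ s hs).resolve_left (by simp)
  have hcard := card_add_one_le_of_notMem hU ht htU
  by_cases hta : t = a
  · subst hta
    have hU0 : U = ∅ := by
      rw [Finset.eq_empty_iff_forall_notMem]
      intro s hs
      have h1 := hρ' s hs
      have h2 : s = t := hρ0 s (by simpa [ρ] using h1)
      exact htU (h2 ▸ hs)
    rw [hU0, hca]
    simpa using hM0
  by_cases htv : t = v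
  · subst htv
    have hUa : ∀ s ∈ U, s = a := by
      intro s hs
      have h1 := hρ' s hs
      rcases hρ1 s (by simpa [ρ, hva] using h1) with h | h
      · exact h
      · exact absurd (h ▸ hs) htU
    have h1 := sum_filter_adj_le (c := c) (T := T) (t := t) fun s hs _ => hUa s hs
    have h2 : U.card ≤ 1 := Finset.card_le_one.2 fun s hs s' hs' => (hUa s hs).trans (hUa s' hs').symm
    rw [hcv]
    omega
  by_cases htb : t = b
  · subst htb
    have hUa : ∀ s ∈ U, s = a ∨ s = v := by
      intro s hs
      have h1 := hρ' s hs
      rcases hρ2 s (by simpa [ρ, hta, htv] using h1) with h | h | h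
      · exact Or.inl h
      · exact Or.inr h
      · exact absurd (h ▸ hs) htU
    have h1 := sum_filter_adj_le (c := c) (T := T) (t := t) (U := U) (p := v) (by
      intro s hs hts
      rcases hUa s hs with rfl | h
      · exact absurd (haB t ht hts.symm) htv
      · exact h)
    have h2 : U.card ≤ 2 := by
      refine le_trans (Finset.card_le_card fun s hs => ?_) (Finset.card_le_two (a := a) (b := v))
      simpa using hUa s hs
    rw [hcb]
    omega
  · have hp : ∀ s ∈ U, T.Adj t s → s = R.par t := by
      intro s hs hts
      rcases R.adj_cases t s hts with ⟨_, h⟩ | ⟨hsa, h⟩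
      · exact h.symm
      · exfalso
        have h1 := hρ' s hs
        have h2 := R.dep_par s hsa
        rw [h] at h2
        by_cases hsv : s = v
        · subst hsv
          exact hta (h.symm.trans hpv)
        by_cases hsb : s = b
        · subst hsb
          exact htv (h.symm.trans (hpb hsv))
        · simp only [ρ, hta, htv, htb, hsa, hsv, hsb, if_false] at h1
          omega
    have hs : ∑ s ∈ U.filter (T.Adj t), (4 + c s) ≤ 6 := by
      by_cases hpU : R.par t ∈ U
      · have h1 := sum_filter_adj_le (c := c) hp
        have h2 : c (R.par t) ≤ 2 := by
          by_cases h1 : R.par t = a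
          · rw [h1, hca]; omega
          by_cases h2 : R.par t = v
          · rw [h2, hcv]; omega
          by_cases h3 : R.par t = b
          · rw [h3, hcb]; omega
          · exact (hc _ (hU hpU) h1 h2 h3).le
        omega
      · rw [sum_filter_adj_eq_zero]
        · omega
        · intro s hs hts
          exact hpU (hp s hs hts ▸ hs)
    rw [hc t ht hta htv htb]
    omega

open scoped Classical in
theorem exists_capEmbedding_of_par_last (hn : Fintype.card V = k + 4)
    (hd : ∀ v, G.degree v + d v + 1 = k)
    (hM0 : (Finset.univ.filter fun v => 0 < d v).card + 1 < k)
    (hM2 : (Finset.univ.filter fun v => 2 < d v).card + B.card + 1 < k)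
    (hB : B.card + 5 < k)
    {a v r : W} (R : Rooting T r) (har : a ≠ r) (hav : R.par a = v) (hvr : v ≠ r) (hvB : v ∈ B)
    (hv : ∀ s, T.Adj v s → s = a ∨ s = R.par v)
    (hca : c a = 0) (hcr : c r = 0) (hcv : c v = k)
    (hc : ∀ t ∈ B, t ≠ a → t ≠ v → t ≠ r → c t = 2) :
    ∃ f, CapEmbedding T G d c B f := by
  obtain ⟨v₀⟩ : Nonempty V := Fintype.card_pos_iff.1 (by omega)
  have hc2 : ∀ t ∈ B, t ≠ v → c t ≤ 2 := by
    intro t ht htv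
    by_cases h1 : t = a
    · rw [h1, hca]; omega
    by_cases h3 : t = r
    · rw [h3, hcr]; omega
    · exact (hc _ ht h1 htv h3).le
  let ρ : W → ℕ := fun w => if w = r then 0 else if w = a then 1 else R.dep w + 1
  have hρ0 : ∀ w, ρ w ≤ 0 → w = r := by
    intro w hw
    simp only [ρ] at hw
    split_ifs at hw <;> first | assumption | omega
  have hρ1 : ∀ w, ρ w ≤ 1 → w = r ∨ w = a := by
    intro w hw
    simp only [ρ] at hw
    split_ifs at hw with h1 h2
    · tauto
    · tauto
    · exact Or.inl (R.eq_root_of_dep_eq_zero (by omega))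
  have hBv := Finset.card_erase_add_one hvB
  obtain ⟨f, hf⟩ := (CapEmbedding.empty (T := T) (G := G) (d := d) (c := c) fun _ => v₀).extend
    (B := B.erase v) hn hd (Finset.empty_subset _) ρ (by
    intro t ht _ U hU htU hρ
    have hρ' : ∀ s ∈ U, ρ s ≤ ρ t := fun s hs => (hρ s hs).resolve_left (by simp)
    have hcard := card_add_one_le_of_notMem hU ht htU
    rw [Finset.mem_erase] at ht
    by_cases htr : t = r
    · subst htr
      have hU0 : U = ∅ := by
        rw [Finset.eq_empty_iff_forall_notMem]
        intro s hs
        have h1 := hρ' s hs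
        have h2 : s = t := hρ0 s (by simpa [ρ] using h1)
        exact htU (h2 ▸ hs)
      rw [hU0, hcr]
      simp only [Finset.card_empty, Finset.filter_empty, Finset.sum_empty]
      omega
    by_cases hta : t = a
    · subst hta
      have hUr : ∀ s ∈ U, s = r := by
        intro s hs
        have h1 := hρ' s hs
        rcases hρ1 s (by simpa [ρ, har] using h1) with h | h
        · exact h
        · exact absurd (h ▸ hs) htU
      have h1 := sum_filter_adj_le (c := c) (T := T) (t := t) fun s hs _ => hUr s hs
      have h2 : U.card ≤ 1 :=
        Finset.card_le_one.2 fun s hs s' hs' => (hUr s hs).trans (hUr s' hs').symm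
      rw [hca]
      omega
    · have hp : ∀ s ∈ U, T.Adj t s → s = R.par t := by
        intro s hs hts
        rcases R.adj_cases t s hts with ⟨_, h⟩ | ⟨hsr, h⟩
        · exact h.symm
        · exfalso
          have h1 := hρ' s hs
          have h2 := R.dep_par s hsr
          rw [h] at h2
          by_cases hsa : s = a
          · subst hsa
            exact ht.1 (h.symm.trans hav)
          · simp only [ρ, hta, htr, hsa, hsr, if_false] at h1
            omega
      have hs : ∑ s ∈ U.filter (T.Adj t), (4 + c s) ≤ 6 := by
        by_cases hpU : R.par t ∈ U
        · have h1 := sum_filter_adj_le (c := c) hp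
          have h2 := Finset.mem_erase.1 (hU hpU)
          have := hc2 _ h2.2 h2.1
          omega
        · rw [sum_filter_adj_eq_zero]
          · omega
          · intro s hs hts
            exact hpU (hp s hs hts ▸ hs)
      rw [hc t ht.2 hta ht.1 htr]
      omega)
  obtain ⟨w, hw⟩ := hf.exists_insert hn hd (Finset.notMem_erase v B) (by
    rw [card_filter_lt_eq_zero hd hcv.ge]
    have h1 : ∑ s ∈ (B.erase v).filter (T.Adj v), (4 + c s) ≤ 4 + 6 := by
      have hsub : (B.erase v).filter (T.Adj v) ⊆ insert a ((B.erase v).filter fun s => s ≠ a ∧ s = R.par v) := by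
        intro s hs
        rw [Finset.mem_filter] at hs
        rw [Finset.mem_insert, Finset.mem_filter]
        exact or_iff_not_imp_left.2 fun h => ⟨hs.1, h, (hv s hs.2).resolve_left h⟩
      refine (Finset.sum_le_sum_of_subset hsub).trans ?_
      rw [Finset.sum_insert (by simp), hca]
      refine Nat.add_le_add_left ?_ 4
      refine (Finset.sum_le_card_nsmul _ _ 6 ?_).trans ?_
      · intro s hs
        have h2 := Finset.mem_erase.1 (Finset.mem_filter.1 hs).1
        have := hc2 _ h2.2 h2.1
        omega
      · have : ((B.erase v).filter fun s => s ≠ a ∧ s = R.par v).card ≤ 1 := by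
          refine Finset.card_le_one.2 fun s hs s' hs' => ?_
          rw [(Finset.mem_filter.1 hs).2.2, (Finset.mem_filter.1 hs').2.2]
        rw [smul_eq_mul]
        omega
    omega)
  rw [Finset.insert_erase hvB] at hw
  exact ⟨_, hw⟩

end Spread

theorem Finset.exists_subset_erase_two {W : Type*} [DecidableEq W] (S : Finset W) (a b : W) :
    ∃ E ⊆ S, a ∉ E ∧ b ∉ E ∧ S.card ≤ E.card + 3 ∧
      (E.Nonempty → ∃ e ∈ S, e ∉ E ∧ e ≠ a ∧ e ≠ b) := by
  have h1 := Finset.pred_card_le_card_erase (s := S) (a := a)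
  have h2 := Finset.pred_card_le_card_erase (s := S.erase a) (a := b)
  have hsub : (S.erase a).erase b ⊆ S :=
    (Finset.erase_subset _ _).trans (Finset.erase_subset _ _)
  rcases ((S.erase a).erase b).eq_empty_or_nonempty with h | ⟨e, he⟩
  · refine ⟨∅, Finset.empty_subset _, by simp, by simp, ?_, by simp⟩
    rw [h, Finset.card_empty] at h2
    omega
  · have h3 := Finset.card_erase_add_one he
    refine ⟨((S.erase a).erase b).erase e, (Finset.erase_subset _ _).trans hsub, by simp, by simp,
      by omega, fun _ => ⟨e, hsub he, by simp, ?_, ?_⟩⟩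
    · rintro rfl
      simp at he
    · rintro rfl
      simp at he

open scoped Classical in
theorem SimpleGraph.IsTree.exists_adj_leaf {W : Type*} [Fintype W] {T : SimpleGraph W}
    {I : Finset W} (hT : T.IsTree) (hI : ∀ w, w ∈ I ↔ 2 ≤ T.degree w) (hne : I.Nonempty)
    (hcard : I.card < Fintype.card W) : ∃ r ∈ I, ∃ y, y ∉ I ∧ T.Adj r y := by
  obtain ⟨r₀, hr₀⟩ := hne
  obtain ⟨R⟩ := hT.nonempty_rooting r₀
  obtain ⟨y, _, hy⟩ := Finset.exists_mem_notMem_of_card_lt_card (s := I) (t := Finset.univ) hcard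
  have hyr : y ≠ r₀ := fun h => hy (h ▸ hr₀)
  exact ⟨R.par y, (hI _).2 (R.two_le_degree_par ((hI _).1 hr₀) hyr), y, hy, (R.adj_par y hyr).symm⟩

section Spread
variable {V W : Type*} [Fintype V] [Fintype W] {G : SimpleGraph V} {T : SimpleGraph W}
  {k : ℕ} {d : V → ℕ} {I S : Finset W}

open scoped Classical in
theorem exists_embedding_of_adj_end (hk : 10 ≤ k) (hn : Fintype.card V = k + 4)
    (hd : ∀ v, G.degree v + d v + 1 = k) (hW : Fintype.card W = k) (hT : T.IsTree)
    (hI : ∀ w, w ∈ I ↔ 2 ≤ T.degree w) (hIk : I.card + 6 ≤ k)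
    (hS : ∀ w, w ∈ S ↔ T.degree w = 2 ∧ ∃ y, y ∉ I ∧ T.Adj w y)
    (hM0 : (Finset.univ.filter fun v => 0 < d v).card < k + 4)
    (hM1 : (Finset.univ.filter fun v => 1 < d v).card + 3 < k)
    (hM2 : (Finset.univ.filter fun v => 2 < d v).card ≤ S.card + 1)
    (hM3 : (Finset.univ.filter fun v => 3 < d v).card + I.card + 3 ≤ k)
    {a b v x y : W} (haI : a ∈ I) (hvI : v ∈ I) (hbI : b ∈ I) (hav : T.Adj a v)
    (haB : ∀ t ∈ I, T.Adj a t → t = v) (hba : b ≠ a)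
    (hvb : b = v ∨ T.Adj v b ∧ ∀ z, T.Adj v z → z ∈ I)
    (hx : x ∉ I) (hax : T.Adj a x) (hy : y ∉ I) (hby : T.Adj b y) :
    ∃ f : W → V, Function.Injective f ∧ ∀ a b, T.Adj a b → G.Adj (f a) (f b) := by
  obtain ⟨R⟩ := hT.nonempty_rooting a
  obtain ⟨E, hES, haE, hbE, hcard, hE⟩ := S.exists_subset_erase_two a b
  have hSI : S ⊆ I := fun w hw => (hI w).2 ((hS w).1 hw).1.ge
  have hva : v ≠ a := hav.ne'
  have hvS : v ∉ S ∨ b = v := by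
    rcases hvb with h | ⟨_, h⟩
    · exact Or.inr h
    · refine Or.inl fun hvS => ?_
      obtain ⟨_, z, hz, hvz⟩ := (hS v).1 hvS
      exact hz (h z hvz)
  have hvE : v ∉ E := by
    rcases hvS with h | rfl
    · exact fun h' => h (hES h')
    · exact hbE
  let c : W → ℕ := fun w => if w = a then 0 else if w = v then 1 else if w = b then 1
    else if w ∈ E then 3 else if w ∈ I then 2 else k
  have hca : c a = 0 := by simp [c]
  have hcv : c v = 1 := by simp [c, hva]
  have hcb : c b = 1 := by simp [c, hba]
  have hcE : ∀ t ∈ E, c t = 3 := by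
    intro t ht
    have h1 : t ≠ a := fun h => haE (h ▸ ht)
    have h2 : t ≠ v := fun h => hvE (h ▸ ht)
    have h3 : t ≠ b := fun h => hbE (h ▸ ht)
    simp [c, h1, h2, h3, ht]
  have hcI : ∀ t, t ∉ I → c t = k := by
    intro t ht
    have h1 : t ≠ a := fun h => ht (h ▸ haI)
    have h2 : t ≠ v := fun h => ht (h ▸ hvI)
    have h3 : t ≠ b := fun h => ht (h ▸ hbI)
    have h4 : t ∉ E := fun h => ht (hSI (hES h))
    simp [c, h1, h2, h3, h4, ht]
  have hc2 : ∀ t ∈ I, t ∉ E → c t ≤ 2 := by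
    intro t ht htE
    simp only [c, ht, htE]
    split_ifs <;> simp_all
  have hIE := Finset.card_sdiff_add_card_eq_card (hES.trans hSI)
  obtain ⟨f, hf⟩ := exists_capEmbedding_of_adj_root (c := c) (B := I \ E) hk hn hd hM0 hM1
    (by omega) R hav (fun t ht => haB t (Finset.mem_sdiff.1 ht).1) hba (hvb.imp_right And.left)
    hca hcv hcb (fun t ht h1 h2 h3 => by
      rw [Finset.mem_sdiff] at ht
      simp [c, h1, h2, h3, ht])
  refine hf.extend_of_degree_two hn hd hW hI hM3
    (fun t ht => ⟨hcE t ht, (hS t).1 (hES ht)⟩) hcI (fun w hw hwE => Or.inl (hc2 w hw hwE))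
    R haI hx hax hca hy hby hcb.le hba.symm fun hne => ?_
  obtain ⟨e, heS, heE, hea, heb⟩ := hE hne
  obtain ⟨_, z, hz, hez⟩ := (hS e).1 heS
  exact ⟨e, z, hz, hez, hc2 e (hSI heS) heE, hea, heb⟩

open scoped Classical in
theorem exists_embedding_of_par_end (hn : Fintype.card V = k + 4)
    (hd : ∀ v, G.degree v + d v + 1 = k) (hW : Fintype.card W = k)
    (hI : ∀ w, w ∈ I ↔ 2 ≤ T.degree w) (hIk : I.card + 6 ≤ k)
    (hS : ∀ w, w ∈ S ↔ T.degree w = 2 ∧ ∃ y, y ∉ I ∧ T.Adj w y)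
    (hM0 : (Finset.univ.filter fun v => 0 < d v).card + 1 < k)
    (hM2 : (Finset.univ.filter fun v => 2 < d v).card ≤ S.card + 1)
    (hM3 : (Finset.univ.filter fun v => 3 < d v).card + I.card + 3 ≤ k)
    {a v r x y : W} (R : Rooting T r) (haI : a ∈ I) (hrI : r ∈ I) (hvI : v ∈ I)
    (har : a ≠ r) (hav : R.par a = v) (hvr : v ≠ r)
    (hv : ∀ s, s ≠ r → R.par s = v → s = a)
    (hx : x ∉ I) (hax : T.Adj a x) (hy : y ∉ I) (hry : T.Adj r y) :
    ∃ f : W → V, Function.Injective f ∧ ∀ a b, T.Adj a b → G.Adj (f a) (f b) := by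
  obtain ⟨E, hES, haE, hrE, hcard, hE⟩ := S.exists_subset_erase_two a r
  have hSI : S ⊆ I := fun w hw => (hI w).2 ((hS w).1 hw).1.ge
  have hva : v ≠ a := hav ▸ R.par_ne har
  have hrd := (hI r).1 hrI
  have hvadj : ∀ s, T.Adj v s → s = a ∨ s = R.par v := by
    intro s hs
    rcases R.adj_cases v s hs with ⟨_, h⟩ | ⟨h, h'⟩
    · exact Or.inr h.symm
    · exact Or.inl (hv s h h')
  have hpvI : R.par v ∈ I := (hI _).2 (R.two_le_degree_par hrd hvr)
  have hvadjI : ∀ s, T.Adj v s → s ∈ I := by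
    intro s hs
    rcases hvadj s hs with rfl | rfl
    · exact haI
    · exact hpvI
  have hvS : v ∉ S := by
    intro h
    obtain ⟨_, z, hz, hvz⟩ := (hS v).1 h
    exact hz (hvadjI z hvz)
  have hvE : v ∉ E := fun h => hvS (hES h)
  have hpvE : R.par v ∉ E := by
    intro h
    obtain ⟨hdeg, z, hz, hpz⟩ := (hS _).1 (hES h)
    have hpr : R.par v ≠ r := fun h' => hrE (h' ▸ h)
    have hzr : z ≠ r := fun h' => hz (h' ▸ hrI)
    have hzp := R.eq_par_of_adj_leaf hrd (by rwa [← hI]) hpz.symm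
    have hvz : v ≠ z := fun h' => hz (h' ▸ hvI)
    have := R.three_le_degree hpr hvr hzr hvz rfl hzp.symm
    omega
  let c : W → ℕ := fun w => if w = a then 0 else if w = v then k else if w = r then 0
    else if w ∈ E then 3 else if w ∈ I then 2 else k
  have hca : c a = 0 := by simp [c]
  have hcv : c v = k := by simp [c, hva]
  have hcr : c r = 0 := by simp [c, hvr.symm]
  have hcE : ∀ t ∈ E, c t = 3 := by
    intro t ht
    have h1 : t ≠ a := fun h => haE (h ▸ ht)
    have h2 : t ≠ v := fun h => hvE (h ▸ ht)
    have h3 : t ≠ r := fun h => hrE (h ▸ ht)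
    simp [c, h1, h2, h3, ht]
  have hcI : ∀ t, t ∉ I → c t = k := by
    intro t ht
    have h1 : t ≠ a := fun h => ht (h ▸ haI)
    have h2 : t ≠ v := fun h => ht (h ▸ hvI)
    have h3 : t ≠ r := fun h => ht (h ▸ hrI)
    have h4 : t ∉ E := fun h => ht (hSI (hES h))
    simp [c, h1, h2, h3, h4, ht]
  have hc2 : ∀ t ∈ I, t ∉ E → t ≠ v → c t ≤ 2 := by
    intro t ht htE htv
    simp only [c, ht, htE, htv]
    split_ifs <;> simp_all
  have hIE := Finset.card_sdiff_add_card_eq_card (hES.trans hSI)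
  obtain ⟨f, hf⟩ := exists_capEmbedding_of_par_last (c := c) (B := I \ E) hn hd hM0
    (by omega) (by omega) R har hav hvr (Finset.mem_sdiff.2 ⟨hvI, hvE⟩) hvadj
    hca hcr hcv (fun t ht h1 h2 h3 => by
      rw [Finset.mem_sdiff] at ht
      simp [c, h1, h2, h3, ht])
  refine hf.extend_of_degree_two hn hd hW hI hM3
    (fun t ht => ⟨hcE t ht, (hS t).1 (hES ht)⟩) hcI (fun w hw hwE => ?_)
    R hrI hx hax hca hy hry hcr.le.step har fun hne => ?_
  · by_cases hwv : w = v
    · subst hwv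
      refine Or.inr fun s hs => ⟨hvadjI s hs, ?_⟩
      rcases hvadj s hs with rfl | rfl
      · exact haE
      · exact hpvE
    · exact Or.inl (hc2 w hw hwE hwv)
  · obtain ⟨e, heS, heE, hea, her⟩ := hE hne
    obtain ⟨_, z, hz, hez⟩ := (hS e).1 heS
    exact ⟨e, z, hz, hez, hc2 e (hSI heS) heE (fun h => hvS (h ▸ heS)), hea, her⟩

open scoped Classical in
theorem exists_embedding_of_many_large_deficiency (hk : 10 ≤ k) (hn : Fintype.card V = k + 4)
    (hd : ∀ v, G.degree v + d v + 1 = k) (hW : Fintype.card W = k) (hT : T.IsTree)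
    (hI : ∀ w, w ∈ I ↔ 2 ≤ T.degree w) (hIk : I.card + 6 ≤ k) (hI2 : 2 ≤ I.card)
    (hS : ∀ w, w ∈ S ↔ T.degree w = 2 ∧ ∃ y, y ∉ I ∧ T.Adj w y)
    (hM0 : (Finset.univ.filter fun v => 0 < d v).card + 1 < k)
    (hM1 : (Finset.univ.filter fun v => 1 < d v).card + 3 < k)
    (hM2 : (Finset.univ.filter fun v => 2 < d v).card ≤ S.card + 1)
    (hM3 : (Finset.univ.filter fun v => 3 < d v).card + I.card + 3 ≤ k) :
    ∃ f : W → V, Function.Injective f ∧ ∀ a b, T.Adj a b → G.Adj (f a) (f b) := by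
  obtain ⟨r, hrI, y, hy, hry⟩ := hT.exists_adj_leaf hI (Finset.card_pos.1 (by omega)) (by omega)
  obtain ⟨R⟩ := hT.nonempty_rooting r
  obtain ⟨a, haI, hmax⟩ := I.exists_max_image R.dep ⟨r, hrI⟩
  have har : a ≠ r := by
    rintro rfl
    obtain ⟨b, hb, hba⟩ := I.exists_mem_ne (by omega) a
    have h1 := hmax b hb
    have h2 := R.dep_pos hba
    rw [R.dep_root] at h1
    omega
  have hleaf : ∀ b ∈ I, b ≠ r → R.dep b = R.dep a → ∃ x, x ∉ I ∧ T.Adj b x := by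
    intro b hb hbr hba
    have h1 := (hI b).1 hb
    rw [← card_neighborFinset_eq_degree] at h1
    obtain ⟨x, hx, hxp⟩ := Finset.exists_mem_ne h1 (R.par b)
    rw [mem_neighborFinset] at hx
    refine ⟨x, fun hxI => ?_, hx⟩
    rcases R.adj_cases b x hx with ⟨_, h⟩ | ⟨hxr, h⟩
    · exact hxp h.symm
    · have h2 := R.dep_par x hxr
      have h3 := hmax x hxI
      rw [h] at h2
      omega
  obtain ⟨x, hx, hax⟩ := hleaf a haI har rfl
  have hpI : R.par a ∈ I := (hI _).2 (R.two_le_degree_par ((hI r).1 hrI) har)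
  have haB : ∀ t ∈ I, T.Adj a t → t = R.par a := by
    intro t ht hat
    rcases R.adj_cases a t hat with ⟨_, h⟩ | ⟨htr, h⟩
    · exact h.symm
    · have h2 := R.dep_par t htr
      have h3 := hmax t ht
      rw [h] at h2
      omega
  by_cases hv : ∃ z, z ∉ I ∧ T.Adj (R.par a) z
  · obtain ⟨z, hz, hvz⟩ := hv
    exact exists_embedding_of_adj_end hk hn hd hW hT hI hIk hS (by omega) hM1 hM2 hM3 haI hpI hpI
      (R.adj_par a har) haB (R.par_ne har) (Or.inl rfl) hx hax hz hvz
  have hv' : ∀ z, T.Adj (R.par a) z → z ∈ I := by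
    intro z hvz
    by_contra hz
    exact hv ⟨z, hz, hvz⟩
  by_cases hb : ∃ b, b ≠ r ∧ R.par b = R.par a ∧ b ≠ a
  · obtain ⟨b, hbr, hpb, hba⟩ := hb
    have hvb : T.Adj (R.par a) b := hpb ▸ (R.adj_par b hbr).symm
    obtain ⟨z, hz, hbz⟩ := hleaf b (hv' b hvb) hbr (by rw [R.dep_par b hbr, hpb, R.dep_par a har])
    exact exists_embedding_of_adj_end hk hn hd hW hT hI hIk hS (by omega) hM1 hM2 hM3 haI hpI
      (hv' b hvb) (R.adj_par a har) haB hba (Or.inr ⟨hvb, hv'⟩) hx hax hz hbz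
  · refine exists_embedding_of_par_end hn hd hW hI hIk hS hM0 hM2 hM3 R haI hrI hpI har rfl ?_ ?_
      hx hax hy hry
    · intro h
      exact hv ⟨y, hy, by rwa [h]⟩
    · intro s hs hps
      by_contra hsa
      exact hb ⟨s, hs, hps, hsa⟩

end Spread

open scoped Classical in
theorem SimpleGraph.IsTree.card_three_le_degree_add_two_le {W : Type*} [Fintype W]
    {T : SimpleGraph W} (hT : T.IsTree) (hW : 1 < Fintype.card W) :
    (Finset.univ.filter fun w => 3 ≤ T.degree w).card +
      (Finset.univ.filter fun w => 2 ≤ T.degree w).card + 2 ≤ Fintype.card W := by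
  have h1 : ∑ w, (1 + (if 2 ≤ T.degree w then 1 else 0) + if 3 ≤ T.degree w then 1 else 0) ≤
      ∑ w, T.degree w := by
    refine Finset.sum_le_sum fun w _ => ?_
    have : Nontrivial W := Fintype.one_lt_card_iff_nontrivial.1 hW
    have := hT.connected.preconnected.degree_pos_of_nontrivial w
    split_ifs <;> omega
  rw [sum_degrees_eq_twice_card_edges, Finset.sum_add_distrib, Finset.sum_add_distrib,
    ← Finset.card_filter, ← Finset.card_filter, Finset.sum_const, Finset.card_univ] at h1
  have h2 := hT.card_edgeFinset
  simp only [smul_eq_mul, mul_one] at h1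
  omega

theorem Rooting.dep_mod_two_ne {W : Type*} {T : SimpleGraph W} {r : W} (R : Rooting T r) {a b : W}
    (h : T.Adj a b) : R.dep a % 2 ≠ R.dep b % 2 := by
  rcases R.adj_cases a b h with ⟨ha, rfl⟩ | ⟨hb, rfl⟩
  · have := R.dep_par a ha
    omega
  · have := R.dep_par b hb
    omega

/-- Every set of vertices of a tree has an independent subset of at least half its size. -/
theorem Rooting.exists_independent_subset {W : Type*} {T : SimpleGraph W} {r : W}
    (R : Rooting T r) (X : Finset W) :
    ∃ Q ⊆ X, X.card ≤ 2 * Q.card ∧ ∀ a ∈ Q, ∀ b ∈ Q, ¬ T.Adj a b := by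
  have h := Finset.card_filter_add_card_filter_not (s := X) fun a => R.dep a % 2 = 0
  rcases le_total (X.filter fun a => R.dep a % 2 = 0).card
    (X.filter fun a => ¬ R.dep a % 2 = 0).card with hle | hle
  · refine ⟨X.filter fun a => ¬ R.dep a % 2 = 0, Finset.filter_subset _ _, by omega, fun a ha b hb hab => ?_⟩
    have := R.dep_mod_two_ne hab
    rw [Finset.mem_filter] at ha hb
    omega
  · refine ⟨X.filter fun a => R.dep a % 2 = 0, Finset.filter_subset _ _, by omega, fun a ha b hb hab => ?_⟩
    have := R.dep_mod_two_ne hab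
    rw [Finset.mem_filter] at ha hb
    omega

open scoped Classical in
theorem exists_embedding_of_sum_deficiency_lt {V W : Type*} [Fintype V] [Fintype W]
    {G : SimpleGraph V} {T : SimpleGraph W} {k : ℕ} {d : V → ℕ} (hk : 9 ≤ k)
    (hn : Fintype.card V = k + 4) (hd : ∀ v, G.degree v + d v + 1 = k)
    (hsum : ∑ v, d v < Fintype.card V) (hW : Fintype.card W = k) (hT : T.IsTree) :
    ∃ f : W → V, Function.Injective f ∧ ∀ a b, T.Adj a b → G.Adj (f a) (f b) := by
  by_cases hbr : (Finset.univ.filter fun w => 3 ≤ T.degree w).card ≤ 3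
  · exact exists_embedding_of_few_branch hk hn.le hd hsum hW hT hbr
  let I : Finset W := Finset.univ.filter fun w => 2 ≤ T.degree w
  let N : Finset W := Finset.univ.filter fun w => 3 ≤ T.degree w
  have hI : ∀ w, w ∈ I ↔ 2 ≤ T.degree w := by simp [I]
  have hNI : N.card + I.card + 2 ≤ Fintype.card W :=
    hT.card_three_le_degree_add_two_le (by omega)
  have hN : 4 ≤ N.card := not_le.1 hbr
  have hNle : N.card ≤ I.card := Finset.card_le_card fun w hw => by
    simp only [N, I, Finset.mem_filter, Finset.mem_univ, true_and] at hw ⊢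
    omega
  obtain ⟨r, hrI, x, hx, hrx⟩ := hT.exists_adj_leaf hI (Finset.card_pos.1 (by omega)) (by omega)
  obtain ⟨R⟩ := hT.nonempty_rooting r
  let S : Finset W := Finset.univ.filter fun w => T.degree w = 2 ∧ ∃ y, y ∉ I ∧ T.Adj w y
  let X : Finset W := Finset.univ.filter fun w => T.degree w = 2 ∧ ¬ ∃ y, y ∉ I ∧ T.Adj w y
  have hS : ∀ w, w ∈ S ↔ T.degree w = 2 ∧ ∃ y, y ∉ I ∧ T.Adj w y := by simp [S]
  have hX : ∀ w, w ∈ X ↔ T.degree w = 2 ∧ ¬ ∃ y, y ∉ I ∧ T.Adj w y := by simp [X]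
  have hISX : I.card ≤ S.card + X.card + N.card := by
    have hsub : I ⊆ S ∪ X ∪ N := by
      intro w hw
      rw [hI] at hw
      rw [Finset.mem_union, Finset.mem_union, hS, hX, Finset.mem_filter]
      rcases hw.eq_or_lt with h | h
      · exact Or.inl (or_iff_not_imp_left.2 fun h' => ⟨h.symm, fun hy => h' ⟨h.symm, hy⟩⟩)
      · exact Or.inr ⟨Finset.mem_univ _, h⟩
    have h1 := Finset.card_le_card hsub
    have h2 := Finset.card_union_le (S ∪ X) N
    have h3 := Finset.card_union_le S X
    omega
  have hSle : S.card + I.card ≤ k := by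
    choose! y hy using fun w (hw : w ∈ S) => ((hS w).1 hw).2
    have h1 : S.card ≤ Iᶜ.card := by
      refine Finset.card_le_card_of_injOn y (fun w hw => by simpa using (hy w hw).1) ?_
      intro w hw w' hw' h
      have h' := hy w' hw'
      rw [← show y w = y w' from h] at h'
      exact R.eq_of_adj_leaf hI hrI h'.1 (hy w hw).2 h'.2
    have h2 := Finset.card_compl_add_card I
    omega
  obtain ⟨Q, hQX, hXQ, hQ⟩ := R.exists_independent_subset X
  have hM := sum_card_lt_le_sum d 4
  simp only [Finset.sum_range_succ, Finset.sum_range_zero, zero_add] at hM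
  have hmono : ∀ i j, i ≤ j → (Finset.univ.filter fun v => j < d v).card ≤
      (Finset.univ.filter fun v => i < d v).card := fun i j hij =>
    Finset.card_le_card (Finset.monotone_filter_right _ fun v _ h => hij.trans_lt h)
  have h01 := hmono 0 1 (by omega)
  have h12 := hmono 1 2 (by omega)
  have h23 := hmono 2 3 (by omega)
  by_cases hcase : (Finset.univ.filter fun v => 1 < d v).card + I.card + 1 ≤ k + Q.card
  · refine exists_embedding_of_few_large_deficiency hn hd hsum hW hI (by omega)
      (fun w hw => (hI w).2 ((hX w).1 (hQX hw)).1.ge) (fun w hw => ?_) hcase R hrI hx hrx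
    have h := (hX w).1 (hQX hw)
    refine ⟨h.1, fun s hs => ⟨?_, fun hsQ => hQ w hw s hsQ hs⟩⟩
    by_contra hsI
    exact h.2 ⟨s, hsI, hs⟩
  · exact exists_embedding_of_many_large_deficiency (S := S) (by omega) hn hd hW hT hI (by omega)
      (by omega) hS (by omega) (by omega) (by omega) (by omega)

/-- Case `Δ(G) = k - 1` of the main theorem (Section 2.5). -/
theorem erdos_sos_n_eq_k_add_four_maxDeg_k_sub_one {V : Type*} [Fintype V]
    (G : SimpleGraph V) [DecidableRel G.Adj] (k : ℕ) (hk : 9 ≤ k)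
    (hn : Fintype.card V = k + 4)
    (havg : (k : ℝ) - 2 < 2 * G.edgeFinset.card / Fintype.card V)
    (hmax : G.maxDegree = k - 1) :
    ∀ (W : Type) [Fintype W] (T : SimpleGraph W), T.IsTree → Fintype.card W = k →
      5 ≤ T.diam → ∃ f : T →g G, Function.Injective f := by
  intro W _ T hT hW _
  have hd : ∀ v, G.degree v + (k - 1 - G.degree v) + 1 = k := by
    intro v
    have := G.degree_le_maxDegree v
    omega
  have hsum : ∑ v, (k - 1 - G.degree v) < Fintype.card V := by
    have h1 : ∑ v, (k - 1 - G.degree v) + ∑ v, G.degree v = (k + 4) * (k - 1) := by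
      rw [← Finset.sum_add_distrib, ← hn, ← smul_eq_mul, ← Finset.card_univ, ← Finset.sum_const]
      refine Finset.sum_congr rfl fun v _ => ?_
      have := hd v
      omega
    rw [sum_degrees_eq_twice_card_edges] at h1
    rw [lt_div_iff₀ (by rw [hn]; positivity), hn] at havg
    obtain ⟨m, rfl⟩ : ∃ m, k = m + 2 := ⟨k - 2, by omega⟩
    have h2 : m * (m + 2 + 4) < 2 * G.edgeFinset.card := by
      have : ((m * (m + 2 + 4) : ℕ) : ℝ) < ((2 * G.edgeFinset.card : ℕ) : ℝ) := by
        push_cast at havg ⊢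
        linarith
      exact_mod_cast this
    rw [show m + 2 - 1 = m + 1 by omega] at h1 ⊢
    rw [hn]
    nlinarith
  obtain ⟨f, hf, hadj⟩ := exists_embedding_of_sum_deficiency_lt (G := G) hk hn
    (fun v => by convert hd v) hsum hW hT
  exact ⟨⟨f, fun h => hadj _ _ h⟩, hf⟩
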